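/- Let X be a geodesic δ-hyperbolic metric space, let G be a group that is not virtually cyclic acting on X by isometries with a unital axial WPD loxodromic element f ∈ G, let x₀ ∈ Ax(f), and let S be a finite generating set of G. Then there exist D₀ > 0 and an element w ∈ S such that for each ε > 0 and each integer D > D₀ there exists a constant N = N(ε,D) such that for every finite set A ⊆ G there exists A' ⊆ A satisfying: (1) #A' ≥ (1−ε)·#A; and (2) for each a ∈ A' there exists b ∈ G with d_S(a,b) ≤ N such that {gx₀ : g ∈ A} ⊆ H_half(bx₀, b f^D x₀) and such that H_half(bx₀, b f^D x₀) and b f^D w f^{−D} b^{−1} · H_half(bx₀, b f^D x₀) are disjoint. -/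

import Mathlib

noncomputable section

open Set Metric Pointwise

/-- The Gromov product `(y|z)_x`. -/
def gromovProd {X : Type*} [MetricSpace X] (x y z : X) : ℝ :=
  (dist x y + dist x z - dist y z) / 2

/-- `γ` restricted to `[a, b]` is a unit-speed geodesic. -/
def IsGeodesicParam {X : Type*} [MetricSpace X] (γ : ℝ → X) (a b : ℝ) : Prop :=
  ∀ s ∈ Set.Icc a b, ∀ t ∈ Set.Icc a b, dist (γ s) (γ t) = |s - t|

/-- `γ` is a geodesic from `x` to `y`, parametrized by arclength on `[0, dist x y]`. -/
def IsGeodesicBetween {X : Type*} [MetricSpace X] (γ : ℝ → X) (x y : X) : Prop :=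
  γ 0 = x ∧ γ (dist x y) = y ∧ IsGeodesicParam γ 0 (dist x y)

/-- A geodesic metric space: any two points are joined by a geodesic. -/
def GeodesicSpace (X : Type*) [MetricSpace X] : Prop :=
  ∀ x y : X, ∃ γ : ℝ → X, IsGeodesicBetween γ x y

/-- A geodesic space in which every geodesic triangle is `δ`-thin. -/
def GromovHyperbolic (X : Type*) [MetricSpace X] (δ : ℝ) : Prop :=
  GeodesicSpace X ∧
    ∀ (x y z : X) (γ₁ γ₂ γ₃ : ℝ → X),
      IsGeodesicBetween γ₁ x z → IsGeodesicBetween γ₂ x y → IsGeodesicBetween γ₃ y z →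
        ∀ t ∈ Set.Icc (0 : ℝ) (dist x z),
          ∃ u ∈ γ₂ '' Set.Icc (0 : ℝ) (dist x y) ∪ γ₃ '' Set.Icc (0 : ℝ) (dist y z),
            dist (γ₁ t) u ≤ δ

/-- A subset of `X` which is the image of a geodesic segment. -/
def IsGeodesicSegSet {X : Type*} [MetricSpace X] (A : Set X) : Prop :=
  ∃ (γ : ℝ → X) (a b : ℝ), a ≤ b ∧ IsGeodesicParam γ a b ∧ A = γ '' Set.Icc a b

/-- The set of nearest-point projections of `x` to `A`. -/
def nearestPts {X : Type*} [MetricSpace X] (A : Set X) (x : X) : Set X :=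
  {a ∈ A | dist x a = Metric.infDist x A}

/-- The nearest-point projection of the set `B` to `A`. -/
def projSet {X : Type*} [MetricSpace X] (A B : Set X) : Set X := ⋃ x ∈ B, nearestPts A x

/-- `diam_A(B)`, the diameter of the projection of `B` to `A`. -/
def projDiam {X : Type*} [MetricSpace X] (A B : Set X) : ℝ := Metric.diam (projSet A B)

/-- `d_A(B, C) = diam (π_A (B ∪ C))`. -/
def projDist {X : Type*} [MetricSpace X] (A B C : Set X) : ℝ := Metric.diam (projSet A (B ∪ C))

/-- The halfspace `H_half(x, y)` of points at least as close to `x` as to `y`. -/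
def halfspace {X : Type*} [MetricSpace X] (x y : X) : Set X := {z | dist z x ≤ dist z y}

/-- A group is virtually cyclic if it has a cyclic subgroup of finite index. -/
def VirtuallyCyclic (G : Type*) [Group G] : Prop :=
  ∃ H : Subgroup G, H.FiniteIndex ∧ IsCyclic H

/-- The WPD property for `f` relative to the basepoint `x₀`. -/
def WPD {G : Type*} [Group G] {X : Type*} [MetricSpace X] [MulAction G X]
    (f : G) (x₀ : X) : Prop :=
  ∀ R : ℝ, 0 < R → ∃ L : ℕ, 0 < L ∧
    {g : G | dist x₀ (g • x₀) < R ∧ dist ((f ^ L) • x₀) ((g * f ^ L) • x₀) < R}.Finite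

/-- The word norm with respect to the generating set `S`. -/
def wordNorm {G : Type*} [Group G] (S : Finset G) (g : G) : ℕ :=
  sInf {n : ℕ | ∃ l : List G, l.length = n ∧ (∀ x ∈ l, x ∈ S ∨ x⁻¹ ∈ S) ∧ l.prod = g}

/-- The word metric with respect to the generating set `S`. -/
def wordDist {G : Type*} [Group G] (S : Finset G) (g h : G) : ℕ := wordNorm S (g⁻¹ * h)

/-- `B` is an `r`-roughly branching subset of `G`. -/
def RoughlyBranching {G : Type*} [Group G] (S : Finset G) (r : ℝ) (B : Set G) : Prop :=
  ∃ B' : Set G,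
    (∀ b ∈ B, ∃ b' ∈ B', (wordDist S b b' : ℝ) ≤ r) ∧
    ∀ k : ℕ, 1 ≤ k → ∀ g h : Fin k → G, (∀ i, g i ∈ B') → (∀ i, h i ∈ B') →
      (List.ofFn g).prod = (List.ofFn h).prod → g = h

/-- The four-point inequality for Gromov products, with additive constant `δ`. -/
def FourPoint (X : Type*) [MetricSpace X] (δ : ℝ) : Prop :=
  ∀ o x y z : X, gromovProd o x y ≤ gromovProd o x z + δ ∨ gromovProd o y z ≤ gromovProd o x z + δ

section Metric

variable {X : Type*} [MetricSpace X]

lemma gromovProd_comm (o x y : X) : gromovProd o x y = gromovProd o y x := by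
  simp only [gromovProd, dist_comm x y]; ring

lemma gromovProd_add_gromovProd (o x y : X) :
    gromovProd o x y + gromovProd x o y = dist o x := by
  simp only [gromovProd, dist_comm x o]; ring

lemma gromovProd_nonneg (o x y : X) : 0 ≤ gromovProd o x y := by
  have := dist_triangle x o y
  simp only [gromovProd, dist_comm o x] at *; linarith

lemma gromovProd_le_dist_left (o x y : X) : gromovProd o x y ≤ dist o x := by
  have := gromovProd_nonneg x o y
  have := gromovProd_add_gromovProd o x y
  linarith

lemma gromovProd_le_dist_right (o x y : X) : gromovProd o x y ≤ dist o y := by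
  rw [gromovProd_comm]; exact gromovProd_le_dist_left o y x

lemma gromovProd_self (o x : X) : gromovProd o x x = dist o x := by
  simp [gromovProd]

lemma gromovProd_le_add_dist_base (o o' x y : X) :
    gromovProd o x y ≤ gromovProd o' x y + dist o o' := by
  have h1 := dist_triangle o o' x
  have h2 := dist_triangle o o' y
  simp only [gromovProd]; linarith

lemma gromovProd_le_add_dist_left (o x x' y : X) :
    gromovProd o x y ≤ gromovProd o x' y + dist x x' := by
  have h1 := dist_triangle o x' x
  have h2 := dist_triangle x' x y
  rw [dist_comm x' x] at h1 h2
  simp only [gromovProd]; linarith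

lemma gromovProd_le_add_dist_right (o x y y' : X) :
    gromovProd o x y ≤ gromovProd o x y' + dist y y' := by
  rw [gromovProd_comm o x y, gromovProd_comm o x y']
  exact gromovProd_le_add_dist_left o y y' x

lemma FourPoint.nonneg {δ : ℝ} (h : FourPoint X δ) (o : X) : 0 ≤ δ := by
  simpa [gromovProd] using h o o o o

lemma FourPoint.left_le {δ : ℝ} (h : FourPoint X δ) {o x y z : X}
    (hlt : gromovProd o x z + δ < gromovProd o y z) :
    gromovProd o x y ≤ gromovProd o x z + δ :=
  (h o x y z).resolve_right (not_le.mpr hlt)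

lemma FourPoint.min_le {δ r : ℝ} (h : FourPoint X δ) {o x y z : X}
    (hx : r ≤ gromovProd o x y) (hz : r ≤ gromovProd o y z) :
    r - δ ≤ gromovProd o x z := by
  rcases h o x y z with h | h <;> linarith

/-- Points on paths from `o` to `p` and from `o` to `p'` at comparable distance from `o` are close
as long as `p` and `p'` have a large Gromov product. -/
lemma FourPoint.dist_le_of_near_paths {δ c : ℝ} (h : FourPoint X δ) {o p p' x y : X}
    (hx : gromovProd x o p ≤ c) (hy : gromovProd y o p' ≤ c)
    (hr : dist o x ≤ gromovProd o p p') (hc : 0 ≤ c) :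
    dist x y ≤ |dist o x - dist o y| + 2 * c + 4 * δ := by
  have h1 := gromovProd_add_gromovProd o x p
  have h2 := gromovProd_add_gromovProd o y p'
  set m := min (dist o x) (dist o y) with hm
  have hm1 : m ≤ dist o x := min_le_left _ _
  have hm2 : m ≤ dist o y := min_le_right _ _
  have h3 : m - c - δ ≤ gromovProd o x p' :=
    h.min_le (y := p) (by linarith) (by linarith)
  have hδ := h.nonneg x
  have h4 : m - c - δ - δ ≤ gromovProd o x y :=
    h.min_le (y := p') (by linarith) (by rw [gromovProd_comm]; linarith)
  have h5 : dist x y = dist o x + dist o y - 2 * gromovProd o x y := by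
    simp only [gromovProd]; ring
  have h6 : dist o x + dist o y - 2 * m = |dist o x - dist o y| := by
    rcases le_total (dist o x) (dist o y) with h | h
    · rw [hm, min_eq_left h, abs_of_nonpos (by linarith)]; ring
    · rw [hm, min_eq_right h, abs_of_nonneg (by linarith)]; ring
  linarith

/-- If `h` lies far from `b` and both are near a path from `o`, in this order, then a point `p`
behind `h` is also behind `b`. -/
lemma FourPoint.gromovProd_le_of_chain {δ c₁ c₂ : ℝ} (hF : FourPoint X δ) {o b h p : X}
    (hb : gromovProd b o h ≤ c₂) (hh : gromovProd h o p ≤ c₁)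
    (hd : c₁ + c₂ + 2 * δ < dist b h) : gromovProd b o p ≤ c₂ + δ := by
  have h1 := gromovProd_add_gromovProd b h o
  have h2 := gromovProd_add_gromovProd b h p
  have hδ := hF.nonneg o
  have h3 : gromovProd h p b ≤ gromovProd h p o + δ := by
    apply hF.left_le
    rw [gromovProd_comm h p o]
    rw [gromovProd_comm b h o] at h1
    linarith
  rw [gromovProd_comm h p b, gromovProd_comm h p o] at h3
  refine (hF.left_le (z := h) ?_).trans (by linarith)
  rw [gromovProd_comm b p h]
  linarith

lemma IsGeodesicBetween.dist_left {γ : ℝ → X} {x y : X} (h : IsGeodesicBetween γ x y)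
    {t : ℝ} (ht : t ∈ Icc 0 (dist x y)) : dist x (γ t) = t := by
  have := h.2.2 0 ⟨le_rfl, dist_nonneg⟩ t ht
  rw [h.1] at this
  rw [this, zero_sub, abs_neg, abs_of_nonneg ht.1]

lemma IsGeodesicBetween.dist_right {γ : ℝ → X} {x y : X} (h : IsGeodesicBetween γ x y)
    {t : ℝ} (ht : t ∈ Icc 0 (dist x y)) : dist (γ t) y = dist x y - t := by
  have := h.2.2 t ht _ ⟨dist_nonneg, le_rfl⟩
  rw [h.2.1] at this
  rw [this, abs_sub_comm, abs_of_nonneg (by linarith [ht.2])]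

lemma IsGeodesicBetween.gromovProd_le {γ : ℝ → X} {x y : X} (h : IsGeodesicBetween γ x y)
    {t : ℝ} (ht : t ∈ Icc 0 (dist x y)) (w : X) : gromovProd w x y ≤ dist w (γ t) := by
  have h1 := h.dist_left ht
  have h2 := h.dist_right ht
  have h3 := dist_triangle w (γ t) x
  have h4 := dist_triangle w (γ t) y
  rw [dist_comm (γ t) x] at h3
  simp only [gromovProd]; linarith

lemma GromovHyperbolic.exists_dist_le {δ : ℝ} (hX : GromovHyperbolic X δ) {γ : ℝ → X} {x y : X}
    (h : IsGeodesicBetween γ x y) (w : X) :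
    ∃ t ∈ Icc 0 (dist x y), dist w (γ t) ≤ gromovProd w x y + 2 * δ + 1 := by
  obtain ⟨γ₂, h₂⟩ := hX.1 x w
  obtain ⟨γ₃, h₃⟩ := hX.1 w y
  have thin := hX.2 x w y γ γ₂ γ₃ h h₂ h₃
  have hδ : 0 ≤ δ := by
    obtain ⟨u, -, hu⟩ := thin 0 ⟨le_rfl, dist_nonneg⟩
    exact dist_nonneg.trans hu
  set A := {t ∈ Icc 0 (dist x y) | ∃ u ∈ γ₂ '' Icc 0 (dist x w), dist (γ t) u ≤ δ} with hA
  set B := {t ∈ Icc 0 (dist x y) | ∃ u ∈ γ₃ '' Icc 0 (dist w y), dist (γ t) u ≤ δ} with hB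
  have hAB : ∀ t ∈ Icc 0 (dist x y), t ∈ A ∨ t ∈ B := by
    intro t ht
    obtain ⟨u, hu | hu, hd⟩ := thin t ht
    · exact Or.inl ⟨ht, u, hu, hd⟩
    · exact Or.inr ⟨ht, u, hu, hd⟩
  have hend : dist x y ∈ B :=
    ⟨⟨dist_nonneg, le_rfl⟩, y, ⟨dist w y, ⟨dist_nonneg, le_rfl⟩, h₃.2.1⟩, by
      rw [h.2.1, dist_self]; exact hδ⟩
  have h0A : (0 : ℝ) ∈ A :=
    ⟨⟨le_rfl, dist_nonneg⟩, x, ⟨0, ⟨le_rfl, dist_nonneg⟩, h₂.1⟩, by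
      rw [h.1, dist_self]; exact hδ⟩
  have hbdd : BddAbove A := ⟨dist x y, fun t ht => ht.1.2⟩
  obtain ⟨t₁, ht₁, t₂, ht₂, h12⟩ : ∃ t₁ ∈ A, ∃ t₂ ∈ B, |t₁ - t₂| ≤ 1 := by
    obtain ⟨t₁, ht₁, hlt⟩ := exists_lt_of_lt_csSup ⟨0, h0A⟩ (sub_lt_self (sSup A) one_half_pos)
    have hle := le_csSup hbdd ht₁
    have hs0 := le_csSup hbdd h0A
    have hsd : sSup A ≤ dist x y := csSup_le ⟨0, h0A⟩ fun t ht => ht.1.2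
    set t₂ := min (sSup A + 1 / 2) (dist x y) with ht₂
    have hs2 : sSup A ≤ t₂ := le_min (by linarith) hsd
    rcases hAB t₂ ⟨by linarith, min_le_right _ _⟩ with hm | hm
    · have h5 := le_csSup hbdd hm
      have : t₂ = dist x y := by
        rcases min_choice (sSup A + 1 / 2) (dist x y) with h6 | h6
        · rw [← ht₂] at h6; linarith
        · exact h6
      exact ⟨t₂, hm, dist x y, hend, by rw [this]; simp⟩
    · have : t₂ ≤ sSup A + 1 / 2 := min_le_left _ _
      exact ⟨t₁, ht₁, t₂, hm, by rw [abs_le]; constructor <;> linarith⟩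
  obtain ⟨ht₁', -, ⟨r, hr, rfl⟩, hu⟩ := ht₁
  obtain ⟨ht₂', -, ⟨r', hr', rfl⟩, hv⟩ := ht₂
  refine ⟨t₁, ht₁', ?_⟩
  have e1 := h₂.dist_left hr
  have e2 := h₂.dist_right hr
  have e3 := h₃.dist_left hr'
  have e4 := h₃.dist_right hr'
  have e5 := h.dist_left ht₁'
  have e6 := h.dist_right ht₁'
  have e7 : dist (γ t₁) (γ₃ r') ≤ δ + 1 := by
    have := dist_triangle (γ t₁) (γ t₂) (γ₃ r')
    rw [h.2.2 _ ht₁' _ ht₂'] at this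
    linarith
  have q1 := dist_triangle w (γ₂ r) (γ t₁)
  have q2 := dist_triangle x (γ₂ r) (γ t₁)
  have q3 := dist_triangle w (γ₃ r') (γ t₁)
  have q4 := dist_triangle (γ t₁) (γ₃ r') y
  rw [dist_comm (γ₂ r) (γ t₁)] at q1 q2
  rw [dist_comm (γ₃ r') (γ t₁)] at q3
  rw [dist_comm (γ₂ r) w] at e2
  rw [dist_comm x w] at e2
  simp only [gromovProd]
  linarith

lemma GromovHyperbolic.fourPoint {δ : ℝ} (hX : GromovHyperbolic X δ) :
    FourPoint X (3 * δ + 1) := by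
  intro o x y z
  obtain ⟨γ, hγ⟩ := hX.1 x z
  obtain ⟨γ₂, h₂⟩ := hX.1 x y
  obtain ⟨γ₃, h₃⟩ := hX.1 y z
  obtain ⟨t, ht, hd⟩ := hX.exists_dist_le hγ o
  obtain ⟨-, ⟨r, hr, rfl⟩ | ⟨r, hr, rfl⟩, hu⟩ := hX.2 x y z γ γ₂ γ₃ hγ h₂ h₃ t ht
  · have := h₂.gromovProd_le hr o
    have := dist_triangle o (γ t) (γ₂ r)
    left; linarith
  · have := h₃.gromovProd_le hr o
    have := dist_triangle o (γ t) (γ₃ r)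
    right; linarith

end Metric

section Action

variable {X : Type*} [MetricSpace X] {G : Type*} [Group G] [MulAction G X]

/-- The orbit of `x₀` under the powers of `f` is an isometrically embedded copy of `ℤ`. -/
def IsAxialOrbit (f : G) (x₀ : X) : Prop :=
  ∀ i j : ℤ, dist (f ^ i • x₀) (f ^ j • x₀) = |(i : ℝ) - j|

lemma IsAxialOrbit.inv {f : G} {x₀ : X} (h : IsAxialOrbit f x₀) : IsAxialOrbit f⁻¹ x₀ := by
  intro i j
  rw [inv_zpow', inv_zpow', h, abs_sub_comm]
  push_cast
  congr 1; ring

lemma IsAxialOrbit.dist_zpow {f : G} {x₀ : X} (h : IsAxialOrbit f x₀) (k : ℤ) :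
    dist x₀ (f ^ k • x₀) = |(k : ℝ)| := by
  simpa using h 0 k

variable [IsIsometricSMul G X]

lemma gromovProd_smul (g : G) (o x y : X) :
    gromovProd (g • o) (g • x) (g • y) = gromovProd o x y := by
  simp [gromovProd, dist_smul]

lemma dist_inv_smul_right (g : G) (x y : X) : dist x (g⁻¹ • y) = dist (g • x) y := by
  rw [← dist_smul g x, smul_inv_smul]

lemma gromovProd_inv_smul (g : G) (x y z : X) :
    gromovProd x (g⁻¹ • y) z = gromovProd (g • x) y (g • z) := by
  rw [← gromovProd_smul g x, smul_inv_smul]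

lemma WPD.inv {f : G} {x₀ : X} (h : WPD f x₀) : WPD f⁻¹ x₀ := by
  intro R hR
  obtain ⟨L, hL, hfin⟩ := h R hR
  refine ⟨L, hL, ?_⟩
  refine (hfin.image fun g => (f ^ L)⁻¹ * g * f ^ L).subset ?_
  rintro g ⟨h1, h2⟩
  refine ⟨f ^ L * g * (f ^ L)⁻¹, ⟨?_, ?_⟩, by group⟩
  · rw [inv_pow] at h2
    rw [← dist_smul (f ^ L)] at h2
    simpa [mul_smul] using h2
  · rw [← dist_smul (f ^ L)] at h1
    simpa [mul_smul] using h1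

/-- If `g` maps a long stretch of the orbit of `f` close to that orbit, matching `f ^ (σ * j) • x₀`
with `f ^ j • x₀`, then `g` conjugates a power of `f ^ σ` to a power of `f`. -/
lemma WPD.exists_conj {f : G} {x₀ : X} (h : WPD f x₀) (R : ℝ) :
    ∃ J : ℕ, ∀ (g : G) (σ : ℤ),
      (∀ j : ℕ, j ≤ J → dist (f ^ j • x₀) (g • f ^ (σ * j) • x₀) ≤ R) →
        ∃ q : ℕ, 0 < q ∧ q ≤ J ∧ f ^ q * g = g * f ^ (σ * q) := by
  obtain ⟨L, hL, hfin⟩ := h (2 * |R| + 1) (by positivity)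
  refine ⟨L + hfin.toFinset.card, fun g σ hg => ?_⟩
  have hR := le_abs_self R
  let e : ℕ → G := fun j => (f ^ j)⁻¹ * g * f ^ (σ * j)
  have hmem : ∀ j ∈ Finset.range (hfin.toFinset.card + 1), e j * g⁻¹ ∈ hfin.toFinset := by
    intro j hj
    have hj' : j ≤ hfin.toFinset.card := by simpa [Nat.lt_succ_iff] using hj
    rw [Set.Finite.mem_toFinset]
    constructor
    · have h1 := hg j (by omega)
      have h2 := hg 0 (by omega)
      have h3 := dist_triangle x₀ (e j • x₀) ((e j * g⁻¹) • x₀)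
      have h4 : dist x₀ (e j • x₀) = dist (f ^ j • x₀) (g • f ^ (σ * j) • x₀) := by
        simp only [e, mul_smul]; rw [dist_inv_smul_right]
      rw [mul_smul, dist_smul, dist_inv_smul_right, h4, dist_comm (g • x₀)] at h3
      simp only [pow_zero, Nat.cast_zero, mul_zero, zpow_zero, one_smul] at h2
      rw [mul_smul]
      linarith
    · have h1 := hg (L + j) (by omega)
      have h2 := hg L (by omega)
      have h3 := dist_triangle (f ^ L • x₀) (e j • f ^ (σ * L) • x₀) ((e j * g⁻¹) • f ^ L • x₀)
      have h4 : dist (f ^ L • x₀) (e j • f ^ (σ * L) • x₀) =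
          dist (f ^ (L + j) • x₀) (g • f ^ (σ * (L + j : ℕ)) • x₀) := by
        simp only [e, mul_smul]
        rw [dist_inv_smul_right, smul_smul, ← pow_add, smul_smul (f ^ (σ * (j : ℤ))), ← zpow_add]
        push_cast
        rw [add_comm j L, mul_add, add_comm (σ * (j : ℤ))]
      rw [mul_smul, dist_smul, dist_inv_smul_right, h4, dist_comm (g • _)] at h3
      rw [mul_smul, mul_smul]
      linarith
  obtain ⟨a, ha, b, hb, hne, hab⟩ := Finset.exists_ne_map_eq_of_card_lt_of_maps_to
    (by simp) hmem
  have key : ∀ a b : ℕ, b < hfin.toFinset.card + 1 → a < b → e a = e b →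
      ∃ q : ℕ, 0 < q ∧ q ≤ L + hfin.toFinset.card ∧ f ^ q * g = g * f ^ (σ * q) := by
    intro a b hb hlt hab
    refine ⟨b - a, by omega, by omega, ?_⟩
    obtain ⟨d, rfl⟩ := Nat.exists_eq_add_of_lt hlt
    have h1 : a + d + 1 - a = d + 1 := by omega
    rw [h1]
    have h2 : f ^ (a + d + 1) * e a * f ^ (-(σ * a)) =
        f ^ (a + d + 1) * e (a + d + 1) * f ^ (-(σ * a)) := by
      rw [hab]
    simp only [e] at h2
    have h3 : f ^ (a + d + 1) = f ^ (d + 1) * f ^ a := by rw [← pow_add]; congr 1; ring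
    have h4 : f ^ (σ * ((a + d + 1 : ℕ) : ℤ)) * f ^ (-(σ * (a : ℤ))) =
        f ^ (σ * ((d + 1 : ℕ) : ℤ)) := by
      rw [← zpow_add]; congr 1; push_cast; ring
    calc f ^ (d + 1) * g
        = f ^ (a + d + 1) * ((f ^ a)⁻¹ * g * f ^ (σ * (a : ℤ))) * f ^ (-(σ * (a : ℤ))) := by
          rw [h3, zpow_neg]; group
      _ = g * (f ^ (σ * ((a + d + 1 : ℕ) : ℤ)) * f ^ (-(σ * (a : ℤ)))) := by
          rw [h2]; simp only [mul_assoc, mul_inv_cancel_left]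
      _ = _ := by rw [h4]
  have hab' := mul_right_cancel hab
  rcases lt_or_gt_of_ne hne with hlt | hlt
  · exact key a b (by simpa using hb) hlt hab'
  · exact key b a (by simpa using ha) hlt hab'.symm

end Action

section Elementary

variable {X : Type*} [MetricSpace X] {G : Type*} [Group G] [MulAction G X] [IsIsometricSMul G X]

/-- If the half-orbits `g f ^ (σ s) x₀` and `f ^ t x₀` have unbounded Gromov products, then `g`
conjugates a power of `f ^ σ` to a power of `f`. -/
lemma WPD.exists_conj_of_unbounded {δ : ℝ} (hF : FourPoint X δ) {f : G} {x₀ : X}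
    (hf : IsAxialOrbit f x₀) (hw : WPD f x₀) (g : G) {σ : ℤ} (hσ : |(σ : ℝ)| = 1)
    (hub : ∀ C : ℝ, ∃ s t : ℕ,
      C < gromovProd x₀ (g • f ^ (σ * (s : ℤ)) • x₀) (f ^ (t : ℤ) • x₀)) :
    ∃ q : ℕ, 0 < q ∧ f ^ q * g = g * f ^ (σ * (q : ℤ)) := by
  have hδ := hF.nonneg x₀
  have hσd : ∀ i j : ℤ, dist (g • f ^ (σ * i) • x₀) (g • f ^ (σ * j) • x₀) = |(i : ℝ) - j| := by
    intro i j
    rw [dist_smul, hf]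
    push_cast
    rw [← mul_sub, abs_mul, hσ, one_mul]
  obtain ⟨J, hJ⟩ := hw.exists_conj (8 * δ + 1)
  obtain ⟨i₀, hi₀⟩ := exists_nat_gt (2 * dist x₀ (g • x₀) + δ + 1)
  obtain ⟨s, t, hst⟩ := hub (i₀ + J)
  set r := dist x₀ (g • x₀) with hr
  set p := f ^ (t : ℤ) • x₀ with hp
  set p' := g • f ^ (σ * (s : ℤ)) • x₀ with hp'
  set d := dist x₀ p' with hd
  have hr0 : 0 ≤ r := dist_nonneg
  have hgp' : dist (g • x₀) p' = s := by
    have := hσd 0 s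
    rw [mul_zero, zpow_zero, one_smul] at this
    rw [hp', this]; simp
  have hpt : dist x₀ p = t := by rw [hp, hf.dist_zpow]; simp
  have htri : |(s : ℝ) - d| ≤ r := by
    rw [← hgp', hr, hd, dist_comm x₀ (g • x₀)]
    exact abs_dist_sub_le _ _ _
  obtain ⟨htri1, htri2⟩ := abs_le.mp htri
  have hle1 := gromovProd_le_dist_left x₀ p' p
  have hle2 := gromovProd_le_dist_right x₀ p' p
  set κ := ⌊(s : ℝ) - d⌋ with hκ
  have hκ1 : (κ : ℝ) ≤ s - d := Int.floor_le _
  have hκ2 : (s : ℝ) - d < κ + 1 := Int.lt_floor_add_one _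
  have claim : ∀ j : ℕ, j ≤ J →
      dist (f ^ ((i₀ : ℤ) + j) • x₀) (g • f ^ (σ * ((i₀ : ℤ) + j + κ)) • x₀) ≤ 8 * δ + 1 := by
    intro j hj
    have hj' : (j : ℝ) ≤ J := by exact_mod_cast hj
    set x := f ^ ((i₀ : ℤ) + j) • x₀ with hx
    set y := g • f ^ (σ * ((i₀ : ℤ) + j + κ)) • x₀ with hy
    have hx0 : dist x₀ x = i₀ + j := by
      rw [hx, hf.dist_zpow]; push_cast; exact abs_of_nonneg (by positivity)
    have hxp : dist x p = t - (i₀ + j) := by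
      rw [hx, hp, hf, abs_sub_comm]; push_cast; exact abs_of_nonneg (by linarith)
    have hgx : gromovProd x x₀ p ≤ δ := by
      simp only [gromovProd]; rw [dist_comm x x₀]; linarith
    have hyg : dist (g • x₀) y = i₀ + j + κ := by
      have := hσd 0 (i₀ + j + κ)
      simp only [mul_zero, zpow_zero, one_smul] at this
      rw [hy, this, abs_sub_comm]
      push_cast
      rw [sub_zero]
      exact abs_of_nonneg (by linarith)
    have hyp : dist y p' = s - (i₀ + j + κ) := by
      rw [hy, hp', hσd, abs_sub_comm]; push_cast; exact abs_of_nonneg (by linarith)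
    have hgy0 : gromovProd y p' (g • x₀) = 0 := by
      simp only [gromovProd]; rw [dist_comm y (g • x₀), dist_comm p' (g • x₀)]; linarith
    have hgy : gromovProd y p' x₀ ≤ δ := by
      rw [← zero_add δ, ← hgy0]
      apply hF.left_le
      have h1 := gromovProd_add_gromovProd (g • x₀) y x₀
      have h2 := gromovProd_le_dist_right (g • x₀) y x₀
      rw [hgy0, gromovProd_comm]
      rw [dist_comm (g • x₀) x₀] at h2
      linarith
    have hgy' : gromovProd y x₀ p' ≤ δ := by rwa [gromovProd_comm]
    have h0 := gromovProd_nonneg y x₀ p'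
    have hdef : gromovProd y x₀ p' = (dist x₀ y + (s - (i₀ + j + κ)) - d) / 2 := by
      simp only [gromovProd]; rw [hyp, dist_comm y x₀]
    have hmain := hF.dist_le_of_near_paths hgx hgy'
      (by rw [gromovProd_comm, hx0]; linarith) hδ
    have habs : |dist x₀ x - dist x₀ y| ≤ 2 * δ + 1 := by
      rw [hx0, abs_le]; constructor <;> linarith
    linarith
  obtain ⟨q, hq, -, hqc⟩ := hJ ((f ^ i₀)⁻¹ * g * f ^ (σ * ((i₀ : ℤ) + κ))) σ (by
    intro j hj
    have := claim j hj
    rw [mul_smul, mul_smul, dist_inv_smul_right, smul_smul, ← pow_add,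
      smul_smul (f ^ (σ * ((i₀ : ℤ) + κ))), ← zpow_add, ← mul_add]
    convert this using 2
    · rw [← zpow_natCast]; push_cast; rfl
    · congr 3; ring)
  refine ⟨q, hq, ?_⟩
  have h1 : f ^ i₀ * (f ^ q * ((f ^ i₀)⁻¹ * g * f ^ (σ * ((i₀ : ℤ) + κ)))) *
      (f ^ (σ * ((i₀ : ℤ) + κ)))⁻¹ = f ^ q * g := by
    rw [← mul_assoc (f ^ i₀), ← pow_add, add_comm, pow_add]
    group
  rw [← h1, hqc]
  have h2 : f ^ (σ * ((i₀ : ℤ) + κ)) * f ^ (σ * (q : ℤ)) =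
      f ^ (σ * (q : ℤ)) * f ^ (σ * ((i₀ : ℤ) + κ)) := by
    rw [← zpow_add, ← zpow_add, add_comm]
  rw [mul_assoc (_ * g), h2]
  group

/-- An isometry commuting with `f ^ N`, where `N` is large, moves the orbit of `f` along itself. -/
lemma dist_le_of_commute {δ : ℝ} (hF : FourPoint X δ) {f : G} {x₀ : X} (hf : IsAxialOrbit f x₀)
    {g : G} {N : ℕ} (hc : Commute (f ^ N) g) {i t : ℤ}
    (hN : |(i : ℝ)| + dist x₀ (g • x₀) + 3 * δ + 1 ≤ N) (ht : |(t : ℝ)| ≤ N) :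
    dist (g • f ^ i • x₀) (f ^ t • x₀) ≤
      |dist (f ^ (-N : ℤ) • x₀) (g • f ^ i • x₀) - (N + t)| + 8 * δ := by
  have hδ := hF.nonneg x₀
  set r := dist x₀ (g • x₀) with hr
  set u := f ^ (-N : ℤ) • x₀ with hu
  set v := f ^ (N : ℤ) • x₀ with hv
  set x := g • f ^ i • x₀ with hx
  obtain ⟨hi1, hi2⟩ := abs_le.mp (le_refl |(i : ℝ)|)
  obtain ⟨ht1, ht2⟩ := abs_le.mp ht
  have hr0 : 0 ≤ r := dist_nonneg
  have hcm : ∀ k : ℤ, dist ((f ^ N) ^ k • x₀) (g • (f ^ N) ^ k • x₀) = r := by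
    intro k
    rw [smul_smul, ← (hc.zpow_left k).eq, mul_smul, dist_smul]
  have hgu : dist u (g • u) = r := by
    have := hcm (-1)
    rwa [← zpow_natCast, ← zpow_mul, mul_neg_one] at this
  have hgv : dist v (g • v) = r := by
    have := hcm 1
    rwa [← zpow_natCast, ← zpow_mul, mul_one] at this
  have hxu : dist x (g • u) = N + i := by
    rw [hx, hu, dist_smul, hf]; push_cast
    rw [abs_of_nonneg (by linarith)]; ring
  have hxv : dist x (g • v) = N - i := by
    rw [hx, hv, dist_smul, hf, abs_sub_comm]; push_cast
    rw [abs_of_nonneg (by linarith)]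
  have huv : dist u v = 2 * N := by
    rw [hu, hv, hf, abs_sub_comm]; push_cast
    rw [abs_of_nonneg (by linarith)]; ring
  have hguv : dist (g • u) (g • v) = 2 * N := by rw [dist_smul, huv]
  have h0 : gromovProd x (g • u) (g • v) = 0 := by
    simp only [gromovProd]; linarith
  have h1 : gromovProd x (g • u) v ≤ δ := by
    rw [← zero_add δ, ← h0]
    apply hF.left_le
    have h2 := gromovProd_le_add_dist_left x (g • v) v (g • v)
    rw [gromovProd_self, dist_comm (g • v) v] at h2
    linarith
  have h2 : gromovProd x u v ≤ 2 * δ := by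
    have h3 : gromovProd x v u ≤ gromovProd x v (g • u) + δ := by
      apply hF.left_le
      have h2 := gromovProd_le_add_dist_left x (g • u) u (g • u)
      rw [gromovProd_self, dist_comm (g • u) u] at h2
      rw [gromovProd_comm]
      linarith
    rw [gromovProd_comm x v, gromovProd_comm x v] at h3
    linarith
  have hyu : dist (f ^ t • x₀) u = N + t := by
    rw [hu, hf]; push_cast
    rw [abs_of_nonneg (by linarith)]; ring
  have hyv : dist (f ^ t • x₀) v = N - t := by
    rw [hv, hf, abs_sub_comm]; push_cast
    rw [abs_of_nonneg (by linarith)]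
  have h3 : gromovProd (f ^ t • x₀) u v ≤ 2 * δ := by
    simp only [gromovProd]; linarith
  have h4 : dist u x ≤ gromovProd u v v := by
    have := dist_triangle u (g • u) x
    rw [gromovProd_self, huv]
    rw [dist_comm (g • u) x] at this
    linarith
  have h5 := hF.dist_le_of_near_paths h2 h3 h4 (by linarith)
  rw [dist_comm u (f ^ t • x₀), hyu] at h5
  linarith

/-- The elements commuting with a power of `f` lie in finitely many cosets of the powers of `f`. -/
lemma WPD.exists_finite_of_commute {δ : ℝ} (hF : FourPoint X δ) {f : G} {x₀ : X}
    (hf : IsAxialOrbit f x₀) (hw : WPD f x₀) :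
    ∃ F : Set G, F.Finite ∧ ∀ g : G, (∃ q : ℕ, 0 < q ∧ Commute (f ^ q) g) →
      ∃ t : ℤ, f ^ t * g ∈ F := by
  have hδ := hF.nonneg x₀
  obtain ⟨L, hL, hfin⟩ := hw (16 * δ + 2) (by positivity)
  refine ⟨_, hfin, ?_⟩
  rintro g ⟨q, hq, hc⟩
  have big : ∀ b : ℝ, ∃ N : ℕ, b ≤ N ∧ ∀ g : G, Commute (f ^ q) g → Commute (f ^ N) g := by
    intro b
    obtain ⟨k, hk⟩ := exists_nat_ge b
    refine ⟨q * k, hk.trans ?_, fun g hg => ?_⟩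
    · exact_mod_cast Nat.le_mul_of_pos_left k hq
    · rw [pow_mul]; exact hg.pow_left k
  obtain ⟨t, ht⟩ : ∃ t : ℤ, dist x₀ ((f ^ t * g) • x₀) ≤ 8 * δ + 1 := by
    obtain ⟨N, hN, hcN⟩ := big (dist x₀ (g • x₀) + 3 * δ + 1)
    set D := dist (f ^ (-N : ℤ) • x₀) (g • f ^ (0 : ℤ) • x₀) with hD
    have h1 : |D - N| ≤ dist x₀ (g • x₀) := by
      have h2 : dist (f ^ (-N : ℤ) • x₀) x₀ = N := by
        rw [dist_comm, hf.dist_zpow]; simp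
      have h3 := abs_dist_sub_le (g • x₀) x₀ (f ^ (-N : ℤ) • x₀)
      rw [hD, zpow_zero, one_smul, dist_comm _ (g • x₀), dist_comm x₀ (g • x₀)]
      rwa [dist_comm x₀ (f ^ _ • x₀), h2] at h3
    obtain ⟨h3, h4⟩ := abs_le.mp h1
    have h5 : (⌊D - N⌋ : ℝ) ≤ D - N := Int.floor_le _
    have h6 : D - N < ⌊D - N⌋ + 1 := Int.lt_floor_add_one _
    refine ⟨-⌊D - N⌋, ?_⟩
    have h7 := dist_le_of_commute hF hf (hcN g hc) (i := 0) (t := ⌊D - N⌋)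
      (by simpa using hN) (by rw [abs_le]; constructor <;> linarith)
    rw [← hD] at h7
    have h8 : |D - (N + ⌊D - N⌋)| ≤ 1 := by rw [abs_le]; constructor <;> linarith
    rw [zpow_neg, mul_smul, dist_inv_smul_right, dist_comm]
    rw [zpow_zero, one_smul] at h7
    linarith
  refine ⟨t, by linarith, ?_⟩
  have hc' : Commute (f ^ q) (f ^ t * g) :=
    Commute.mul_right ((Commute.refl f).pow_left q |>.zpow_right t) hc
  set g' := f ^ t * g
  obtain ⟨N, hN, hcN⟩ := big (L + dist x₀ (g' • x₀) + 3 * δ + 1)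
  have hNL : (L : ℝ) ≤ N := by linarith [dist_nonneg (x := x₀) (y := g' • x₀)]
  have h7 := dist_le_of_commute hF hf (hcN g' hc') (i := L) (t := L)
    (by simpa using hN) (by simpa using hNL)
  have h9 : dist (g' • f ^ (-N : ℤ) • x₀) (g' • f ^ (L : ℤ) • x₀) = N + L := by
    rw [dist_smul, hf, abs_sub_comm]; push_cast
    rw [abs_of_nonneg (by linarith)]; ring
  have h10 : dist (f ^ (-N : ℤ) • x₀) (g' • f ^ (-N : ℤ) • x₀) = dist x₀ (g' • x₀) := by
    have h11 := (hcN g' hc').zpow_left (-1)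
    rw [← zpow_natCast, ← zpow_mul, mul_neg_one] at h11
    rw [smul_smul, ← h11.eq, mul_smul, dist_smul]
  have h12 : |dist (f ^ (-N : ℤ) • x₀) (g' • f ^ (L : ℤ) • x₀) - (N + (L : ℤ))| ≤
      dist x₀ (g' • x₀) := by
    push_cast
    rw [← h9, ← h10]
    exact abs_dist_sub_le _ _ _
  rw [mul_smul, dist_comm]
  rw [← zpow_natCast]
  linarith

/-- If every element of `G` conjugates a power of `f` to itself or its inverse, then `G` is
virtually cyclic. -/
lemma WPD.virtuallyCyclic {δ : ℝ} (hF : FourPoint X δ) {f : G} {x₀ : X}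
    (hf : IsAxialOrbit f x₀) (hw : WPD f x₀)
    (h : ∀ g : G, ∃ q : ℕ, 0 < q ∧ (f ^ q * g = g * f ^ q ∨ f ^ q * g = g * (f ^ q)⁻¹)) :
    VirtuallyCyclic G := by
  obtain ⟨F, hfin, hFc⟩ := hw.exists_finite_of_commute hF hf
  refine ⟨Subgroup.zpowers f, ?_, inferInstance⟩
  obtain ⟨E, hE, hcov⟩ : ∃ E : Set G, E.Finite ∧ ∀ g : G, ∃ t : ℤ, f ^ t * g ∈ E := by
    by_cases hrev : ∃ r : G, ∃ q : ℕ, 0 < q ∧ f ^ q * r = r * (f ^ q)⁻¹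
    · obtain ⟨r, q, hq, hr⟩ := hrev
      refine ⟨F ∪ (fun g => g * r⁻¹) '' F, hfin.union (hfin.image _), fun g => ?_⟩
      obtain ⟨q', hq', hg | hg⟩ := h g
      · obtain ⟨t, ht⟩ := hFc g ⟨q', hq', hg⟩
        exact ⟨t, Or.inl ht⟩
      · obtain ⟨t, ht⟩ := hFc (g * r) ⟨q * q', Nat.mul_pos hq hq', by
          have hg1 : SemiconjBy g (f ^ q')⁻¹ (f ^ q') := hg.symm
          have hr1 : SemiconjBy r (f ^ q)⁻¹ (f ^ q) := hr.symm
          have hg2 := hg1.pow_right q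
          have hr2 := (hr1.inv_right).pow_right q'
          rw [inv_inv, ← inv_pow, ← pow_mul, ← pow_mul] at hr2
          rw [← inv_pow, ← pow_mul, ← pow_mul, mul_comm q' q] at hg2
          exact (hg2.mul_left hr2).symm⟩
        exact ⟨t, Or.inr ⟨_, ht, by group⟩⟩
    · refine ⟨F, hfin, fun g => ?_⟩
      obtain ⟨q', hq', hg | hg⟩ := h g
      · exact hFc g ⟨q', hq', hg⟩
      · exact absurd ⟨g, q', hq', hg⟩ hrev
  have : Finite E := hE
  have : Finite (G ⧸ Subgroup.zpowers f) := by
    refine Finite.of_surjective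
      (fun e : E => QuotientGroup.mk (s := Subgroup.zpowers f) (e : G)⁻¹) ?_
    intro y
    obtain ⟨g, rfl⟩ := QuotientGroup.mk_surjective y
    obtain ⟨t, ht⟩ := hcov g⁻¹
    refine ⟨⟨_, ht⟩, ?_⟩
    simp only
    rw [QuotientGroup.eq]
    refine ⟨t, ?_⟩
    group
  exact Subgroup.finiteIndex_of_finite_quotient

end Elementary

section Transverse

variable {X : Type*} [MetricSpace X] {G : Type*} [Group G] [MulAction G X]

/-- The orbit of `f` and its translate by `g` diverge in all directions, with constant `C`. -/
def Transverse (f : G) (x₀ : X) (g : G) (C : ℝ) : Prop :=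
  ∀ s t : ℤ, gromovProd x₀ (g • f ^ s • x₀) (f ^ t • x₀) ≤ C

variable [IsIsometricSMul G X]

lemma WPD.exists_bound {δ : ℝ} (hF : FourPoint X δ) {f : G} {x₀ : X}
    (hf : IsAxialOrbit f x₀) (hw : WPD f x₀) (g : G) {σ : ℤ} (hσ : |(σ : ℝ)| = 1)
    (hg : ∀ q : ℕ, 0 < q → f ^ q * g ≠ g * f ^ (σ * (q : ℤ))) :
    ∃ C : ℝ, ∀ s t : ℕ, gromovProd x₀ (g • f ^ (σ * (s : ℤ)) • x₀) (f ^ (t : ℤ) • x₀) ≤ C := by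
  by_contra! h
  obtain ⟨q, hq, hqg⟩ := hw.exists_conj_of_unbounded hF hf g hσ h
  exact hg q hq hqg

lemma WPD.exists_transverse {δ : ℝ} (hF : FourPoint X δ) {f : G} {x₀ : X}
    (hf : IsAxialOrbit f x₀) (hw : WPD f x₀) (hG : ¬ VirtuallyCyclic G) :
    ∃ (z : G) (C : ℝ), Transverse f x₀ z C := by
  obtain ⟨z, hz⟩ : ∃ z : G, ∀ q : ℕ, 0 < q → f ^ q * z ≠ z * f ^ q ∧ f ^ q * z ≠ z * (f ^ q)⁻¹ := by
    by_contra! h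
    refine hG (hw.virtuallyCyclic hF hf fun g => ?_)
    obtain ⟨q, hq, hqg⟩ := h g
    exact ⟨q, hq, or_iff_not_imp_left.mpr hqg⟩
  obtain ⟨C₁, h₁⟩ := hw.exists_bound hF hf z (σ := 1) (by simp) fun q hq h =>
    (hz q hq).1 (by simpa using h)
  obtain ⟨C₂, h₂⟩ := hw.exists_bound hF hf z (σ := -1) (by simp) fun q hq h =>
    (hz q hq).2 (by simpa using h)
  obtain ⟨C₃, h₃⟩ := hw.inv.exists_bound hF hf.inv z (σ := 1) (by simp) fun q hq h => by
    have h1 : SemiconjBy z (f ^ q)⁻¹ (f ^ q)⁻¹ := by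
      simpa [SemiconjBy, eq_comm] using h
    exact (hz q hq).1 (SemiconjBy.inv_right_iff.mp h1).symm
  obtain ⟨C₄, h₄⟩ := hw.inv.exists_bound hF hf.inv z (σ := -1) (by simp) fun q hq h => by
    have h1 : SemiconjBy z (f ^ q) (f ^ q)⁻¹ := by
      simpa [SemiconjBy, eq_comm] using h
    exact (hz q hq).2 (by simpa [SemiconjBy, eq_comm] using h1.inv_right)
  refine ⟨z, max (max C₁ C₂) (max C₃ C₄), fun s t => ?_⟩
  obtain ⟨a, rfl | rfl⟩ := s.eq_nat_or_neg <;> obtain ⟨b, rfl | rfl⟩ := t.eq_nat_or_neg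
  · exact (by simpa using h₁ a b : _ ≤ C₁).trans (by simp)
  · exact (by simpa using h₄ a b : _ ≤ C₄).trans (by simp)
  · exact (by simpa using h₂ a b : _ ≤ C₂).trans (by simp)
  · exact (by simpa using h₃ a b : _ ≤ C₃).trans (by simp)

/-- A finite generating set contains an element whose translate of the negative half-orbit of `f`
diverges from that half-orbit. -/
lemma WPD.exists_generator {δ : ℝ} (hF : FourPoint X δ) {f : G} {x₀ : X}
    (hf : IsAxialOrbit f x₀) (hw : WPD f x₀) (hG : ¬ VirtuallyCyclic G)
    {S : Set G} (hS : Subgroup.closure S = ⊤) :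
    ∃ w ∈ S, ∃ C : ℝ, ∀ s t : ℕ,
      gromovProd x₀ (w • f ^ (-(s : ℤ)) • x₀) (f ^ (-(t : ℤ)) • x₀) ≤ C := by
  obtain ⟨w, hwS, hwf⟩ : ∃ w ∈ S, ∀ q : ℕ, 0 < q → ¬ Commute (f ^ q) w := by
    by_contra! h
    refine hG (hw.virtuallyCyclic hF hf fun g => ?_)
    have hg : g ∈ Subgroup.closure S := hS ▸ Subgroup.mem_top g
    suffices ∃ q : ℕ, 0 < q ∧ Commute (f ^ q) g by
      obtain ⟨q, hq, hc⟩ := this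
      exact ⟨q, hq, Or.inl hc⟩
    induction hg using Subgroup.closure_induction with
    | mem x hx => exact h x hx
    | one => exact ⟨1, one_pos, Commute.one_right _⟩
    | mul x y _ _ hx hy =>
      obtain ⟨q, hq, hc⟩ := hx
      obtain ⟨r, hr, hd⟩ := hy
      refine ⟨q * r, Nat.mul_pos hq hr, Commute.mul_right ?_ ?_⟩
      · rw [pow_mul]; exact hc.pow_left r
      · rw [mul_comm, pow_mul]; exact hd.pow_left q
    | inv x _ hx =>
      obtain ⟨q, hq, hc⟩ := hx
      exact ⟨q, hq, hc.inv_right⟩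
  obtain ⟨C, hC⟩ := hw.inv.exists_bound hF hf.inv w (σ := 1) (by simp) fun q hq h => by
    refine hwf q hq (Commute.inv_left_iff.mp ?_)
    simpa [Commute, SemiconjBy] using h
  refine ⟨w, hwS, C, fun s t => ?_⟩
  simpa using hC s t

lemma dist_inv_smul_self (g : G) (x : X) : dist x (g⁻¹ • x) = dist x (g • x) := by
  rw [dist_inv_smul_right, dist_comm]

lemma Transverse.inv {f : G} {x₀ : X} {g : G} {C : ℝ} (h : Transverse f x₀ g C) :
    Transverse f x₀ g⁻¹ (C + dist x₀ (g • x₀)) := by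
  intro s t
  rw [gromovProd_inv_smul, gromovProd_comm]
  refine (gromovProd_le_add_dist_base _ x₀ _ _).trans ?_
  rw [dist_comm]
  exact add_le_add_left (h t s) _

lemma Transverse.mul_zpow_mul {δ : ℝ} (hF : FourPoint X δ) {f : G} {x₀ : X}
    (hf : IsAxialOrbit f x₀) {u v : G} {C : ℝ} (hu : Transverse f x₀ u C)
    (hv : Transverse f x₀ v C) {k : ℤ} (hk : 2 * dist x₀ (u • x₀) + 2 * C + δ < |(k : ℝ)|) :
    Transverse f x₀ (u * f ^ k * v) (C + δ) := by
  intro s t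
  set y := (u * f ^ k) • x₀ with hy
  have h1 : gromovProd x₀ (f ^ t • x₀) y ≤ C := by
    rw [gromovProd_comm, hy, mul_smul]; exact hu k t
  have h2 : gromovProd y x₀ ((u * f ^ k * v) • f ^ s • x₀) ≤ C + dist x₀ (u • x₀) := by
    rw [mul_smul, hy, ← gromovProd_inv_smul, mul_inv_rev, mul_smul, gromovProd_comm, ← zpow_neg]
    refine (gromovProd_le_add_dist_right _ _ _ (f ^ (-k) • x₀)).trans ?_
    rw [dist_smul, dist_comm, dist_inv_smul_self]
    exact add_le_add_left (hv s (-k)) _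
  have h3 := gromovProd_add_gromovProd x₀ y ((u * f ^ k * v) • f ^ s • x₀)
  have h4 : |(k : ℝ)| ≤ dist x₀ (u • x₀) + dist x₀ y := by
    have := dist_triangle (u • x₀) x₀ y
    rw [hy, mul_smul, dist_smul, hf.dist_zpow, dist_comm (u • x₀)] at this
    rwa [hy, mul_smul]
  rw [gromovProd_comm]
  refine (hF.left_le (z := y) ?_).trans (by linarith)
  rw [gromovProd_comm x₀ ((u * f ^ k * v) • f ^ s • x₀) y]
  linarith

/-- There are arbitrarily large families of translates of the orbit of `f` which pairwise diverge,
together with their inverses, and which avoid the orbit of `f`. -/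
lemma Transverse.exists_family {δ : ℝ} (hF : FourPoint X δ) {f : G} {x₀ : X}
    (hf : IsAxialOrbit f x₀) {z : G} {C : ℝ} (hz : Transverse f x₀ z C) (m : ℕ) :
    ∃ C₂ : ℝ, 0 ≤ C₂ ∧ ∀ M₀ : ℝ, ∃ w : Fin m → G, (∀ i, M₀ ≤ dist x₀ (w i • x₀)) ∧
      (∀ i j, i ≠ j → gromovProd x₀ (w i • x₀) (w j • x₀) ≤ C₂) ∧
      (∀ i j, i ≠ j → gromovProd x₀ ((w i)⁻¹ • x₀) ((w j)⁻¹ • x₀) ≤ C₂) ∧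
      ∀ i, ∀ k : ℤ, gromovProd x₀ ((w i)⁻¹ • x₀) (f ^ k • x₀) ≤ C + 2 * δ := by
  have hδ := hF.nonneg x₀
  have hC : 0 ≤ C := (gromovProd_nonneg _ _ _).trans (hz 0 0)
  set r := dist x₀ (z • x₀) with hr
  have hr0 : 0 ≤ r := dist_nonneg
  obtain ⟨c, hc⟩ := exists_nat_gt (2 * r + 2 * (C + r) + δ)
  let g : Fin m → G := fun i => z * f ^ ((c : ℤ) * ((i : ℕ) + 1)) * z
  have hg : ∀ i, Transverse f x₀ (g i) (C + δ) := by
    intro i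
    refine hz.mul_zpow_mul hF hf hz ?_
    push_cast
    rw [abs_of_nonneg (by positivity)]
    have : (c : ℝ) * 1 ≤ c * ((i : ℕ) + 1) :=
      mul_le_mul_of_nonneg_left (by simp) (by positivity)
    linarith
  have hgg : ∀ i j, i ≠ j → Transverse f x₀ ((g i)⁻¹ * g j) (C + r + δ) := by
    intro i j hij
    have h1 : (g i)⁻¹ * g j = z⁻¹ * f ^ ((c : ℤ) * ((j : ℕ) - (i : ℕ))) * z := by
      simp only [g]
      have : (c : ℤ) * ((j : ℕ) - (i : ℕ)) =
          -((c : ℤ) * ((i : ℕ) + 1)) + (c : ℤ) * ((j : ℕ) + 1) := by ring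
      rw [this, zpow_add, zpow_neg]
      group
    rw [h1]
    refine hz.inv.mul_zpow_mul hF hf (fun s t => (hz s t).trans (by linarith)) ?_
    rw [dist_inv_smul_self, ← hr]
    push_cast
    rw [abs_mul, abs_of_nonneg (by positivity : (0 : ℝ) ≤ c)]
    have h2 : (1 : ℝ) ≤ |((j : ℕ) : ℝ) - (i : ℕ)| := by
      have h3 : ((j : ℕ) : ℤ) - (i : ℕ) ≠ 0 := by
        intro h; exact hij (Fin.ext (by omega))
      exact_mod_cast Int.one_le_abs h3
    have : (c : ℝ) * 1 ≤ c * |((j : ℕ) : ℝ) - (i : ℕ)| :=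
      mul_le_mul_of_nonneg_left h2 (by positivity)
    linarith
  set B := ∑ i, dist x₀ (g i • x₀) with hB
  have hgB : ∀ i, dist x₀ (g i • x₀) ≤ B := fun i =>
    Finset.single_le_sum (f := fun i => dist x₀ (g i • x₀)) (fun _ _ => dist_nonneg)
      (Finset.mem_univ i)
  have hB0 : 0 ≤ B := Finset.sum_nonneg fun _ _ => dist_nonneg
  have hnear : ∀ i (k : ℤ),
      dist ((g i * f ^ k * (g i)⁻¹) • x₀) (g i • f ^ k • x₀) ≤ B := by
    intro i k
    rw [mul_smul, mul_smul, dist_smul, dist_smul, dist_comm, dist_inv_smul_self]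
    exact hgB i
  have hpair : ∀ i j, i ≠ j → ∀ k : ℤ, gromovProd x₀ ((g i * f ^ k * (g i)⁻¹) • x₀)
      ((g j * f ^ k * (g j)⁻¹) • x₀) ≤ C + r + δ + 3 * B := by
    intro i j hij k
    have h1 := gromovProd_le_add_dist_left x₀ ((g i * f ^ k * (g i)⁻¹) • x₀) (g i • f ^ k • x₀)
      ((g j * f ^ k * (g j)⁻¹) • x₀)
    have h2 := gromovProd_le_add_dist_right x₀ (g i • f ^ k • x₀)
      ((g j * f ^ k * (g j)⁻¹) • x₀) (g j • f ^ k • x₀)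
    have h3 := gromovProd_le_add_dist_base x₀ (g i • x₀) (g i • f ^ k • x₀) (g j • f ^ k • x₀)
    have h4 := hgg i j hij k k
    rw [mul_smul, gromovProd_inv_smul, gromovProd_comm] at h4
    have := hnear i k
    have := hnear j k
    have := hgB i
    linarith
  refine ⟨C + r + δ + 3 * B, by positivity, fun M₀ => ?_⟩
  obtain ⟨M, hM⟩ := exists_nat_gt (max M₀ (C + 2 * δ) + 2 * B)
  have hM1 := le_max_left M₀ (C + 2 * δ)
  have hM2 := le_max_right M₀ (C + 2 * δ)
  have hdist : ∀ i (k : ℤ), |(k : ℝ)| - B ≤ dist x₀ (g i • f ^ k • x₀) := by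
    intro i k
    have := dist_triangle (g i • x₀) x₀ (g i • f ^ k • x₀)
    rw [dist_smul, hf.dist_zpow, dist_comm (g i • x₀)] at this
    have := hgB i
    linarith
  have hinv : ∀ i, (g i * f ^ (M : ℤ) * (g i)⁻¹)⁻¹ = g i * f ^ (-(M : ℤ)) * (g i)⁻¹ := by
    intro i; group
  refine ⟨fun i => g i * f ^ (M : ℤ) * (g i)⁻¹, fun i => ?_, fun i j hij => hpair i j hij _,
    fun i j hij => ?_, fun i k => ?_⟩
  · have h1 := hdist i M
    have h2 := hnear i M
    have h3 := dist_triangle x₀ ((g i * f ^ (M : ℤ) * (g i)⁻¹) • x₀) (g i • f ^ (M : ℤ) • x₀)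
    simp only [Int.cast_natCast, Nat.abs_cast] at h1
    linarith
  · rw [hinv, hinv]
    exact hpair i j hij _
  · rw [hinv, gromovProd_comm]
    have h1 := hg i (-M) k
    rw [gromovProd_comm] at h1
    refine (hF.left_le (z := g i • f ^ (-(M : ℤ)) • x₀) ?_).trans (by linarith)
    have h2 := hdist i (-M)
    have h3 := hnear i (-M)
    have h4 := gromovProd_le_add_dist_right x₀ (g i • f ^ (-(M : ℤ)) • x₀)
      (g i • f ^ (-(M : ℤ)) • x₀) ((g i * f ^ (-(M : ℤ)) * (g i)⁻¹) • x₀)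
    rw [gromovProd_self, dist_comm (g i • _), gromovProd_comm] at h4
    simp only [Int.cast_neg, Int.cast_natCast, abs_neg, Nat.abs_cast] at h2
    linarith

end Transverse

section Shadow

variable {X : Type*} [MetricSpace X] {G : Type*} [Group G] [MulAction G X] [IsIsometricSMul G X]

lemma FourPoint.gromovProd_le_of_le {δ C : ℝ} (hF : FourPoint X δ) {o p h e : X}
    (hh : gromovProd h o e ≤ C) (hp : dist h e - δ ≤ gromovProd h p e)
    (hn : C + 2 * δ < dist h e) : gromovProd h o p ≤ C + δ :=
  (hF.left_le (z := e) (by linarith)).trans (by linarith)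

/-- If `p` lies behind the segment from `h` to `h f ^ n`, which points away from `o`, then this
segment is close to any path from `o` to `p`. -/
lemma FourPoint.gromovProd_axis_le {δ C : ℝ} (hF : FourPoint X δ) {f : G} {x₀ : X}
    (hf : IsAxialOrbit f x₀) {o p : X} {h : G} {n τ : ℕ}
    (hh : ∀ k : ℤ, gromovProd (h • x₀) o (h • f ^ k • x₀) ≤ C)
    (hp : n - δ ≤ gromovProd (h • x₀) p (h • f ^ (n : ℤ) • x₀))
    (hn : C + 2 * δ < n) (hτ : τ ≤ n) :
    gromovProd (h • f ^ (τ : ℤ) • x₀) o p ≤ 2 * C + 4 * δ := by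
  have hδ := hF.nonneg x₀
  have hτ' : (τ : ℝ) ≤ n := by exact_mod_cast hτ
  have hdist : ∀ k : ℕ, dist (h • x₀) (h • f ^ (k : ℤ) • x₀) = k := by
    intro k; rw [dist_smul, hf.dist_zpow]; simp
  have hHp := hF.gromovProd_le_of_le (hh n) (by rwa [hdist]) (by rwa [hdist])
  have hHY := hdist τ
  have hHE := hdist n
  have hYE : dist (h • f ^ (τ : ℤ) • x₀) (h • f ^ (n : ℤ) • x₀) = n - τ := by
    rw [dist_smul, hf, abs_sub_comm]; push_cast; exact abs_of_nonneg (by linarith)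
  have hHo := hh τ
  have hC : 0 ≤ C := (gromovProd_nonneg _ _ _).trans hHo
  set H := h • x₀
  set Y := h • f ^ (τ : ℤ) • x₀
  set E := h • f ^ (n : ℤ) • x₀
  have h1 : gromovProd H Y E = τ := by simp only [gromovProd]; linarith
  have h2 : (τ : ℝ) - δ - δ ≤ gromovProd H Y p :=
    hF.min_le (y := E) (by linarith) (by rw [gromovProd_comm]; linarith)
  have h3 := gromovProd_add_gromovProd H Y p
  have h4 := gromovProd_add_gromovProd H Y o
  rcases le_or_gt (τ : ℝ) (C + 3 * δ) with h5 | h5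
  · have h6 := gromovProd_le_add_dist_base Y H o p
    rw [dist_comm Y H] at h6
    linarith
  · rw [gromovProd_comm]
    refine (hF.left_le (z := H) ?_).trans ?_ <;> rw [gromovProd_comm Y p H]
    · rw [gromovProd_comm Y o H]
      rw [gromovProd_comm H Y o] at h4
      linarith
    · linarith

/-- Two translates of the axis of `f` whose shadows, seen from `o`, contain points with a large
Gromov product, differ by one of finitely many elements of `G`. -/
lemma WPD.exists_finset_of_shadows {δ C : ℝ} (hF : FourPoint X δ) {f : G} {x₀ : X}
    (hf : IsAxialOrbit f x₀) (hw : WPD f x₀) :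
    ∃ (F : Finset G) (L : ℝ), 0 ≤ L ∧ ∀ (o p₁ p₂ : X) (h₁ h₂ : G) (n : ℕ),
      (∀ k : ℤ, gromovProd (h₁ • x₀) o (h₁ • f ^ k • x₀) ≤ C) →
      (∀ k : ℤ, gromovProd (h₂ • x₀) o (h₂ • f ^ k • x₀) ≤ C) →
      n - δ ≤ gromovProd (h₁ • x₀) p₁ (h₁ • f ^ (n : ℤ) • x₀) →
      n - δ ≤ gromovProd (h₂ • x₀) p₂ (h₂ • f ^ (n : ℤ) • x₀) →
      dist o (h₁ • x₀) ≤ dist o (h₂ • x₀) →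
      dist o (h₂ • x₀) + L ≤ dist o (h₁ • x₀) + n →
      dist o (h₂ • x₀) + L ≤ gromovProd o p₁ p₂ → h₁⁻¹ * h₂ ∈ F := by
  classical
  have hδ := hF.nonneg x₀
  rcases lt_or_ge C 0 with hC | hC
  · exact ⟨∅, 0, le_rfl, fun o _ _ h₁ _ _ hh _ _ _ _ _ _ =>
      absurd ((gromovProd_nonneg _ _ _).trans (hh 0)) (not_le.mpr hC)⟩
  set R := 6 * C + 12 * δ + 1 with hR
  obtain ⟨J, hJ⟩ := hw.exists_conj R
  obtain ⟨L, -, hfin⟩ := hw (R + 1) (by positivity)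
  obtain ⟨K, hK⟩ := exists_nat_ge (2 * J + R + 2 * C)
  refine ⟨(Finset.range (K + 1) ×ˢ hfin.toFinset).image fun x => f ^ x.1 * x.2,
    J + L + C + 2 * δ + 1, by positivity, ?_⟩
  intro o p₁ p₂ h₁ h₂ n hh₁ hh₂ hp₁ hp₂ hs hn hp
  set s₁ := dist o (h₁ • x₀)
  set s₂ := dist o (h₂ • x₀)
  have hLn : C + 2 * δ < n := by
    have := Nat.cast_nonneg (α := ℝ) J
    have := Nat.cast_nonneg (α := ℝ) L
    linarith
  set k := ⌊s₂ - s₁⌋₊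
  have hk1 : (k : ℝ) ≤ s₂ - s₁ := Nat.floor_le (by linarith)
  have hk2 : s₂ - s₁ < k + 1 := Nat.lt_floor_add_one _
  have hlow : ∀ (h : G), (∀ k : ℤ, gromovProd (h • x₀) o (h • f ^ k • x₀) ≤ C) → ∀ k : ℤ,
      dist o (h • x₀) + |(k : ℝ)| - 2 * C ≤ dist o (h • f ^ k • x₀) := by
    intro h hh k
    have := hh k
    simp only [gromovProd] at this
    rw [dist_smul, hf.dist_zpow, dist_comm _ o] at this
    linarith
  have hup : ∀ (h : G) (k : ℤ), dist o (h • f ^ k • x₀) ≤ dist o (h • x₀) + |(k : ℝ)| := by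
    intro h k
    have := dist_triangle o (h • x₀) (h • f ^ k • x₀)
    rwa [dist_smul, hf.dist_zpow] at this
  have hclose : ∀ t : ℕ, t ≤ J + L →
      dist (h₁ • f ^ ((k + t : ℕ) : ℤ) • x₀) (h₂ • f ^ (t : ℤ) • x₀) ≤ R := by
    intro t ht
    have ht' : (t : ℝ) ≤ J + L := by exact_mod_cast ht
    have a1 := hlow h₁ hh₁ (k + t : ℕ)
    have a2 := hup h₁ (k + t : ℕ)
    have a3 := hlow h₂ hh₂ t
    have a4 := hup h₂ t
    rw [Int.cast_natCast, Nat.abs_cast] at a1 a2 a3 a4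
    have e : ((k + t : ℕ) : ℝ) = k + t := Nat.cast_add k t
    have b1 : k + t ≤ n := by
      have : ((k + t : ℕ) : ℝ) ≤ n := by linarith
      exact_mod_cast this
    have b2 : t ≤ n := by omega
    have c1 := hF.gromovProd_axis_le hf hh₁ hp₁ hLn b1
    have c2 := hF.gromovProd_axis_le hf hh₂ hp₂ hLn b2
    have c3 := hF.dist_le_of_near_paths c1 c2 (by linarith) (by positivity)
    have c4 : |dist o (h₁ • f ^ ((k + t : ℕ) : ℤ) • x₀) - dist o (h₂ • f ^ (t : ℤ) • x₀)| ≤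
        2 * C + 1 := by
      rw [abs_le]; constructor <;> linarith
    linarith
  set g := (h₁ * f ^ k)⁻¹ * h₂ with hg
  have hgd : ∀ t : ℕ, t ≤ J + L → dist (f ^ t • x₀) (g • f ^ t • x₀) ≤ R := by
    intro t ht
    have h1 := hclose t ht
    rw [hg, mul_smul, dist_inv_smul_right, smul_smul, mul_assoc, ← pow_add, mul_smul]
    rwa [zpow_natCast, zpow_natCast] at h1
  have hgF : g ∈ hfin.toFinset := by
    rw [Set.Finite.mem_toFinset]
    constructor
    · have := hgd 0 (by omega)
      rw [pow_zero, one_smul] at this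
      linarith
    · have := hgd L (by omega)
      rw [mul_smul]
      linarith
  obtain ⟨q, hq, hqJ, hqg⟩ := hJ g 1 (fun j hj => by
    simpa using hgd j (by omega))
  rw [one_mul, zpow_natCast] at hqg
  have hgk : h₁⁻¹ * h₂ = f ^ k * g := by rw [hg]; group
  have hkK : k ≤ K := by
    have e1 : h₂ * f ^ (-(q * (k / q) : ℕ) : ℤ) = h₁ * f ^ (k % q) * g := by
      have e2 : SemiconjBy g (f ^ (q * (k / q))) (f ^ (q * (k / q))) := by
        rw [pow_mul]
        exact SemiconjBy.pow_right hqg.symm _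
      have e3 : h₂ = h₁ * f ^ k * g := by rw [hg]; group
      have e4 : f ^ k = f ^ (k % q) * f ^ (q * (k / q)) := by
        rw [← pow_add, Nat.mod_add_div]
      rw [zpow_neg, zpow_natCast, mul_inv_eq_iff_eq_mul, mul_assoc _ g, e2.eq, ← mul_assoc,
        mul_assoc h₁, ← e4, e3]
    have e5 := hlow h₂ hh₂ (-(q * (k / q) : ℕ) : ℤ)
    rw [smul_smul h₂, e1, mul_smul, mul_smul] at e5
    have e6 := dist_triangle o (h₁ • f ^ (k % q) • x₀) (h₁ • f ^ (k % q) • g • x₀)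
    rw [dist_smul, dist_smul] at e6
    have e7 := hgd 0 (by omega)
    rw [pow_zero, one_smul] at e7
    have e8 := hup h₁ (k % q : ℕ)
    rw [zpow_natCast] at e8
    have e9 : ((k % q : ℕ) : ℝ) + (q * (k / q) : ℕ) = k := by
      exact_mod_cast Nat.mod_add_div k q
    have e10 : ((k % q : ℕ) : ℝ) ≤ q := by exact_mod_cast (Nat.mod_lt k hq).le
    have e11 : (q : ℝ) ≤ J := by exact_mod_cast hqJ
    rw [Int.cast_neg, abs_neg, Int.cast_natCast, Nat.abs_cast] at e5
    rw [Int.cast_natCast, Nat.abs_cast] at e8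
    have : (k : ℝ) ≤ K := by linarith
    exact_mod_cast this
  rw [hgk]
  refine Finset.mem_image.mpr ⟨(k, g), Finset.mem_product.mpr ⟨?_, hgF⟩, rfl⟩
  exact Finset.mem_range.mpr (Nat.lt_succ_of_le hkK)

end Shadow

section Doubling

open scoped Finset

/-- Assign to each `x ∈ Q` the lowest candidate in `B` if there is one, and `p x ∈ P` otherwise. If
at most `K` elements of `Q` above a given one can share its assigned value, then
`#Q ≤ K * (#B + #P)`. -/
lemma Finset.card_le_mul_of_candidates {α β γ : Type*} {Q : Finset α} {B : Finset β}
    {P : Finset γ} (s : α → ℝ) (t : β → ℝ) (p : α → γ) (hp : ∀ x ∈ Q, p x ∈ P)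
    (r : α → β → Prop) {K : ℕ}
    (hfib : ∀ x₁ ∈ Q, ∀ R ⊆ Q, (∀ x₂ ∈ R, s x₁ ≤ s x₂ ∧
      ((p x₁ = p x₂ ∧ ∀ b ∈ B, ¬ r x₁ b) ∨
        ∃ b ∈ B, r x₁ b ∧ r x₂ b ∧ ∀ b' ∈ B, r x₁ b' → t b ≤ t b')) → #R ≤ K) :
    #Q ≤ K * (#B + #P) := by
  classical
  have hc : ∀ x, ∃ c : β ⊕ γ, x ∈ Q → (c ∈ B.disjSum P ∧
      ((c = Sum.inr (p x) ∧ ∀ b ∈ B, ¬ r x b) ∨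
        ∃ b ∈ B, c = Sum.inl b ∧ r x b ∧ ∀ b' ∈ B, r x b' → t b ≤ t b')) := by
    intro x
    by_cases h : (B.filter (r x)).Nonempty
    · obtain ⟨b, hb, hmin⟩ := Finset.exists_min_image _ t h
      rw [Finset.mem_filter] at hb
      exact ⟨Sum.inl b, fun _ => ⟨Finset.inl_mem_disjSum.mpr hb.1, Or.inr
        ⟨b, hb.1, rfl, hb.2, fun b' hb' hr => hmin b' (Finset.mem_filter.mpr ⟨hb', hr⟩)⟩⟩⟩
    · rw [Finset.not_nonempty_iff_eq_empty, Finset.filter_eq_empty_iff] at h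
      exact ⟨Sum.inr (p x), fun hx => ⟨Finset.inr_mem_disjSum.mpr (hp x hx), Or.inl ⟨rfl, h⟩⟩⟩
  choose c hc using hc
  rw [← Finset.card_disjSum]
  refine Finset.card_le_mul_card_image_of_maps_to (f := c) (fun x hx => (hc x hx).1) K ?_
  intro y _
  rcases (Q.filter fun x => c x = y).eq_empty_or_nonempty with he | hne
  · rw [he]; simp
  · obtain ⟨x₁, hx₁, hmin⟩ := Finset.exists_min_image _ s hne
    rw [Finset.mem_filter] at hx₁
    refine hfib x₁ hx₁.1 _ (Finset.filter_subset _ _) fun x₂ hx₂ => ⟨hmin x₂ hx₂, ?_⟩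
    rw [Finset.mem_filter] at hx₂
    have hcc : c x₁ = c x₂ := hx₁.2.trans hx₂.2.symm
    rcases (hc x₁ hx₁.1).2 with ⟨h1, h1'⟩ | ⟨b, hb, h1, h1', h1''⟩ <;>
      rcases (hc x₂ hx₂.1).2 with ⟨h2, -⟩ | ⟨b₂, -, h2, h2', -⟩
    · left
      rw [h1, h2] at hcc
      exact ⟨Sum.inr_injective hcc, h1'⟩
    · rw [h1, h2] at hcc; cases hcc
    · rw [h1, h2] at hcc; cases hcc
    · rw [h1, h2] at hcc
      cases hcc
      exact Or.inr ⟨b, hb, h1', h2', h1''⟩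

variable {X : Type*} [MetricSpace X] {G : Type*} [Group G] [MulAction G X] [IsIsometricSMul G X]

/-- There is a finite set `W` such that if every shadow of a translate `b w f ^ n`, `b ∈ B` and
`w ∈ W`, meets `P`, then `P` is at least twice as large as `B`. -/
lemma WPD.exists_doubling {δ : ℝ} (hF : FourPoint X δ) {f : G} {x₀ : X}
    (hf : IsAxialOrbit f x₀) (hw : WPD f x₀) {z : G} {C : ℝ} (hz : Transverse f x₀ z C) :
    ∃ (W : Finset G) (n : ℕ), ∀ (B : Finset G) (P : Finset X),
      (∀ b ∈ B, ∀ w ∈ W, ∃ p ∈ P,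
        n - δ ≤ gromovProd ((b * w) • x₀) p ((b * w) • f ^ (n : ℤ) • x₀)) →
      2 * #B ≤ #P := by
  classical
  have hδ := hF.nonneg x₀
  have hC : 0 ≤ C := (gromovProd_nonneg _ _ _).trans (hz 0 0)
  obtain ⟨F, L, hL, hsh⟩ := hw.exists_finset_of_shadows (C := C + 3 * δ) hF hf
  set K := #(insert 1 F) with hK
  have hK1 : 0 < K := Finset.card_pos.mpr (Finset.insert_nonempty _ _)
  have hFK : #F ≤ K := Finset.card_le_card (Finset.subset_insert _ _)
  obtain ⟨C₂, hC₂, hfam⟩ := hz.exists_family hF hf (3 * K + 1)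
  obtain ⟨w, hw1, hw2, hw3, hw4⟩ := hfam (4 * C₂ + C + 12 * δ + 1)
  set T := L + 2 * C₂ + 7 * δ + 1 with hT
  set M := ∑ i, dist x₀ (w i • x₀) with hM
  have hwM : ∀ i, dist x₀ (w i • x₀) ≤ M := fun i =>
    Finset.single_le_sum (f := fun i => dist x₀ (w i • x₀)) (fun _ _ => dist_nonneg)
      (Finset.mem_univ i)
  have hM0 : 0 ≤ M := Finset.sum_nonneg fun _ _ => dist_nonneg
  obtain ⟨n, hn⟩ := exists_nat_gt (T + L + M + 2 * C + 12 * δ)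
  refine ⟨Finset.univ.image w, n, fun B P hBP => ?_⟩
  have hBP' : ∀ x : G × Fin (3 * K + 1), ∃ q : X, x.1 ∈ B →
      (q ∈ P ∧ n - δ ≤ gromovProd ((x.1 * w x.2) • x₀) q ((x.1 * w x.2) • f ^ (n : ℤ) • x₀)) := by
    intro x
    by_cases hx : x.1 ∈ B
    · obtain ⟨q, hq⟩ := hBP x.1 hx (w x.2) (Finset.mem_image_of_mem _ (Finset.mem_univ _))
      exact ⟨q, fun _ => hq⟩
    · exact ⟨x₀, fun h => absurd h hx⟩
  choose p hp using hBP'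
  let good : G × Fin (3 * K + 1) → Prop := fun x =>
    gromovProd (x.1 • x₀) x₀ ((x.1 * w x.2) • x₀) ≤ C₂ + δ
  set Q := (B ×ˢ (Finset.univ : Finset (Fin (3 * K + 1)))).filter good with hQ
  have hQmem : ∀ x ∈ Q, x.1 ∈ B ∧ good x := by
    intro x hx
    rw [hQ, Finset.mem_filter, Finset.mem_product] at hx
    exact ⟨hx.1.1, hx.2⟩
  have hQcard : 3 * K * #B ≤ #Q := by
    have h1 : #Q = ∑ b ∈ B, #(Finset.univ.filter fun i => good (b, i)) := by
      rw [hQ, Finset.card_filter, Finset.sum_product]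
      refine Finset.sum_congr rfl fun b _ => ?_
      rw [Finset.card_filter]
    rw [h1, mul_comm, ← smul_eq_mul]
    refine Finset.card_nsmul_le_sum _ _ _ fun b _ => ?_
    have h2 : #(Finset.univ.filter fun i => ¬ good (b, i)) ≤ 1 := by
      rw [Finset.card_le_one]
      intro i hi j hj
      by_contra hij
      simp only [Finset.mem_filter, Finset.mem_univ, true_and, good, not_le] at hi hj
      have h3 := hw2 i j hij
      have h4 := lt_min hi hj
      have h5 : _ ≤ gromovProd (b • x₀) ((b * w i) • x₀) ((b * w j) • x₀) :=
        hF.min_le (y := x₀) ((min_le_left _ _).trans_eq (gromovProd_comm _ _ _)) (min_le_right _ _)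
      rw [mul_smul, mul_smul, gromovProd_smul, ← mul_smul, ← mul_smul] at h5
      linarith
    have h3 := Finset.card_filter_add_card_filter_not (s := Finset.univ)
      (fun i : Fin (3 * K + 1) => good (b, i))
    rw [Finset.card_univ, Fintype.card_fin] at h3
    omega
  set s : G × Fin (3 * K + 1) → ℝ := fun x => dist x₀ ((x.1 * w x.2) • x₀) with hs
  have hlen : ∀ x : G × Fin (3 * K + 1),
      dist (x.1 • x₀) ((x.1 * w x.2) • x₀) = dist x₀ (w x.2 • x₀) := by
    intro x; rw [mul_smul, dist_smul]
  have hback : ∀ x ∈ Q, 3 * C₂ + C + 4 * δ + 1 ≤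
      gromovProd ((x.1 * w x.2) • x₀) (x.1 • x₀) x₀ := by
    intro x hx
    have h1 : gromovProd _ _ _ ≤ _ := (hQmem x hx).2
    have h2 := gromovProd_add_gromovProd (x.1 • x₀) ((x.1 * w x.2) • x₀) x₀
    rw [hlen, gromovProd_comm _ _ x₀] at h2
    linarith [hw1 x.2]
  have haxis : ∀ x ∈ Q, ∀ k : ℤ, gromovProd ((x.1 * w x.2) • x₀) x₀
      ((x.1 * w x.2) • f ^ k • x₀) ≤ C + 3 * δ := by
    intro x hx k
    have h1 := hback x hx
    have h2 := hw4 x.2 k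
    rw [← gromovProd_smul (x.1 * w x.2), smul_smul _ (w x.2)⁻¹, mul_inv_cancel_right] at h2
    rw [gromovProd_comm] at h1 h2 ⊢
    exact (hF.left_le (by linarith)).trans (by linarith)
  have hnear : ∀ x ∈ Q, gromovProd ((x.1 * w x.2) • x₀) x₀ (p x) ≤ C + 4 * δ := by
    intro x hx
    have hd : dist ((x.1 * w x.2) • x₀) ((x.1 * w x.2) • f ^ (n : ℤ) • x₀) = n := by
      rw [dist_smul, hf.dist_zpow]; simp
    have := hF.gromovProd_le_of_le (haxis x hx n)
      (by rw [hd]; exact (hp x (hQmem x hx).1).2) (by rw [hd]; linarith)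
    linarith
  have hchain : ∀ x ∈ Q, gromovProd (x.1 • x₀) x₀ (p x) ≤ C₂ + 2 * δ := by
    intro x hx
    have := hF.gromovProd_le_of_chain (hQmem x hx).2 (hnear x hx)
      (by rw [hlen]; linarith [hw1 x.2])
    linarith
  have hs1 : ∀ x, s x ≤ dist x₀ (x.1 • x₀) + M := by
    intro x
    have := dist_triangle x₀ (x.1 • x₀) ((x.1 * w x.2) • x₀)
    rw [hlen] at this
    linarith [hwM x.2]
  have hs2 : ∀ x ∈ Q, dist x₀ (x.1 • x₀) ≤ s x := by
    intro x hx
    have h1 : gromovProd _ _ _ ≤ _ := (hQmem x hx).2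
    simp only [gromovProd] at h1
    rw [hlen, dist_comm _ x₀] at h1
    linarith [hw1 x.2]
  have hinj : ∀ x ∈ Q, ∀ y ∈ Q, x.1 * w x.2 = y.1 * w y.2 → x = y := by
    intro x hx y hy hxy
    have h1 := hback x hx
    have h2 := hback y hy
    have hij : x.2 = y.2 := by
      by_contra hij
      have h3 := hw3 x.2 y.2 hij
      rw [← gromovProd_smul (x.1 * w x.2), smul_smul _ (w x.2)⁻¹, mul_inv_cancel_right,
        hxy, smul_smul _ (w y.2)⁻¹, mul_inv_cancel_right] at h3
      rw [hxy] at h1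
      rw [gromovProd_comm] at h2
      have := hF.min_le h1 h2
      linarith
    rw [hij] at hxy
    exact Prod.ext (mul_right_cancel hxy) hij
  have hcard : #Q ≤ K * (#B + #P) := by
    refine Finset.card_le_mul_of_candidates s (fun b : G => dist x₀ (b • x₀)) p
      (fun x hx => (hp x (hQmem x hx).1).1)
      (fun x b => s x + T ≤ dist x₀ (b • x₀) ∧ gromovProd (b • x₀) x₀ (p x) ≤ C₂ + 3 * δ) ?_
    intro x₁ hx₁ R hRQ hR
    refine le_trans (Finset.card_le_card_of_injOn (t := F)
      (fun x => (x₁.1 * w x₁.2)⁻¹ * (x.1 * w x.2)) ?_ ?_) hFK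
    · intro x₂ hx₂
      have hx₂Q := hRQ hx₂
      obtain ⟨hle, hcase⟩ := hR x₂ hx₂
      have hbehind : ∀ (b : G) (x : G × Fin (3 * K + 1)), s x + T ≤ dist x₀ (b • x₀) →
          gromovProd (b • x₀) x₀ (p x) ≤ C₂ + 3 * δ →
          dist x₀ (b • x₀) - (C₂ + 3 * δ) ≤ gromovProd x₀ (b • x₀) (p x) := by
        intro b x _ h2
        linarith [gromovProd_add_gromovProd x₀ (b • x₀) (p x)]
      have hlt : s x₂ + L ≤ s x₁ + n := by
        by_contra! hgt
        have hcand : s x₁ + T ≤ dist x₀ (x₂.1 • x₀) := by linarith [hs1 x₂]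
        rcases hcase with ⟨hpp, hno⟩ | ⟨b, hb, ⟨h1, h1'⟩, ⟨h2, h2'⟩, hmin⟩
        · refine hno x₂.1 (hQmem x₂ hx₂Q).1 ⟨hcand, ?_⟩
          rw [hpp]
          linarith [hchain x₂ hx₂Q]
        · have h3 := hbehind b x₁ h1 h1'
          have h4 := hbehind b x₂ h2 h2'
          rw [gromovProd_comm] at h3
          have h5 := hF.min_le h3 h4
          have h6 := gromovProd_le_add_dist_base x₀ (x₂.1 • x₀) (p x₁) (p x₂)
          have h7 := hs2 x₂ hx₂Q
          have h8 := hchain x₂ hx₂Q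
          have h9 : gromovProd (x₂.1 • x₀) x₀ (p x₁) ≤ C₂ + 3 * δ :=
            (hF.left_le (z := p x₂) (by linarith)).trans (by linarith)
          have := hmin x₂.1 (hQmem x₂ hx₂Q).1 ⟨hcand, h9⟩
          linarith
      refine hsh x₀ (p x₁) (p x₂) _ _ n (haxis x₁ hx₁) (haxis x₂ hx₂Q)
        (hp x₁ (hQmem x₁ hx₁).1).2 (hp x₂ (hQmem x₂ hx₂Q).1).2 hle hlt ?_
      rcases hcase with ⟨hpp, -⟩ | ⟨b, -, ⟨h1, h1'⟩, ⟨h2, h2'⟩, -⟩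
      · rw [hpp, gromovProd_self]
        have h1 := hnear x₂ hx₂Q
        have h2 := gromovProd_le_dist_left ((x₂.1 * w x₂.2) • x₀) (p x₂)
          ((x₂.1 * w x₂.2) • f ^ (n : ℤ) • x₀)
        have h3 := (hp x₂ (hQmem x₂ hx₂Q).1).2
        simp only [gromovProd] at h1
        rw [dist_comm _ x₀] at h1
        linarith
      · have h3 := hbehind b x₁ h1 h1'
        have h4 := hbehind b x₂ h2 h2'
        rw [gromovProd_comm] at h3
        have h5 := hF.min_le h3 h4
        linarith
    · intro x hx y hy hxy
      exact hinj x (hRQ hx) y (hRQ hy) (mul_left_cancel hxy)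
  have h1 : K * (3 * #B) ≤ K * (#B + #P) := by
    calc K * (3 * #B) = 3 * K * #B := by ring
      _ ≤ _ := hQcard.trans hcard
  have := Nat.le_of_mul_le_mul_left h1 hK1
  omega

end Doubling

section Halfspace

variable {X : Type*} [MetricSpace X] {G : Type*} [Group G] [MulAction G X] [IsIsometricSMul G X]

lemma le_gromovProd_of_mem_halfspace {x y u : X} (hu : u ∈ halfspace x y) :
    dist x y / 2 ≤ gromovProd y u x := by
  have : dist u x ≤ dist u y := hu
  simp only [gromovProd]
  rw [dist_comm y u, dist_comm y x]
  linarith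

/-- If `w` moves the negative half-orbit of `f` away from itself, then large conjugates of `w` move
the corresponding halfspaces off themselves. -/
lemma disjoint_halfspace_smul {δ C : ℝ} (hF : FourPoint X δ) {f : G} {x₀ : X}
    (hf : IsAxialOrbit f x₀) {w : G}
    (hw : ∀ s t : ℕ, gromovProd x₀ (w • f ^ (-(s : ℤ)) • x₀) (f ^ (-(t : ℤ)) • x₀) ≤ C)
    {D : ℤ} (hD : 0 ≤ D) (hCD : 2 * (C + δ + dist x₀ (w • x₀)) < D) (b : G) :
    Disjoint (halfspace (b • x₀) ((b * f ^ D) • x₀))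
      ((b * f ^ D * w * f ^ (-D) * b⁻¹) • halfspace (b • x₀) ((b * f ^ D) • x₀)) := by
  lift D to ℕ using hD
  rw [Set.disjoint_left]
  rintro _ hv ⟨u, hu, rfl⟩
  have key : ∀ v, b • v ∈ halfspace (b • x₀) ((b * f ^ (D : ℤ)) • x₀) →
      (D : ℝ) / 2 ≤ gromovProd x₀ (f ^ (-(D : ℤ)) • v) (f ^ (-(D : ℤ)) • x₀) := by
    intro v hv
    have h1 := le_gromovProd_of_mem_halfspace hv
    rw [mul_smul, gromovProd_smul, dist_smul, hf.dist_zpow] at h1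
    rw [← gromovProd_smul (f ^ (D : ℤ)), smul_smul, smul_smul, ← zpow_add, add_neg_cancel,
      zpow_zero, one_smul, one_smul]
    simpa using h1
  have h1 := key (b⁻¹ • u) (by rwa [smul_inv_smul])
  have h2 := key ((f ^ (D : ℤ) * w * f ^ (-(D : ℤ)) * b⁻¹) • u) (by
    rw [smul_smul]; simpa only [mul_assoc] using hv)
  have e : f ^ (-(D : ℤ)) • ((f ^ (D : ℤ) * w * f ^ (-(D : ℤ)) * b⁻¹) • u) =
      w • f ^ (-(D : ℤ)) • b⁻¹ • u := by
    simp only [smul_smul]; congr 1; group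
  rw [e] at h2
  have h3 := gromovProd_le_add_dist_base (w • x₀) x₀ (w • f ^ (-(D : ℤ)) • b⁻¹ • u)
    (w • f ^ (-(D : ℤ)) • x₀)
  rw [gromovProd_smul, dist_comm] at h3
  have h4 := hF.min_le (o := x₀) (r := (D : ℝ) / 2 - dist x₀ (w • x₀))
    (x := w • f ^ (-(D : ℤ)) • x₀) (y := w • f ^ (-(D : ℤ)) • b⁻¹ • u)
    (z := f ^ (-(D : ℤ)) • x₀) (by rw [gromovProd_comm]; linarith)
    (by linarith [dist_nonneg (x := x₀) (y := w • x₀)])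
  have h5 := hw D D
  push_cast at hCD
  linarith

/-- A point outside of the halfspace at `h f ^ n` lies behind the segment from `h` to `h f ^ n`. -/
lemma le_gromovProd_of_notMem_halfspace {δ : ℝ} (hF : FourPoint X δ) {f : G} {x₀ : X}
    (hf : IsAxialOrbit f x₀) {D : ℤ} (hD : 0 ≤ D) (hδD : 2 * δ ≤ D) {h : G} {n : ℕ} {p : X}
    (hp : p ∉ halfspace ((h * f ^ (n : ℤ)) • x₀) ((h * f ^ (n : ℤ) * f ^ D) • x₀)) :
    n - δ ≤ gromovProd (h • x₀) p (h • f ^ (n : ℤ) • x₀) := by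
  have hD' : (0 : ℝ) ≤ D := by exact_mod_cast hD
  have hlt : dist p ((h * f ^ (n : ℤ) * f ^ D) • x₀) < dist p ((h * f ^ (n : ℤ)) • x₀) :=
    not_le.mp hp
  rw [mul_assoc, ← zpow_add, mul_smul, mul_smul] at hlt
  have h1 : dist (h • x₀) (h • f ^ (n : ℤ) • x₀) = n := by
    rw [dist_smul, hf.dist_zpow]; simp
  have h2 : dist (h • f ^ (n : ℤ) • x₀) (h • f ^ ((n : ℤ) + D) • x₀) = D := by
    rw [dist_smul, hf, abs_sub_comm]; push_cast
    rw [add_sub_cancel_left, abs_of_nonneg hD']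
  have h3 : dist (h • x₀) (h • f ^ ((n : ℤ) + D) • x₀) = n + D := by
    rw [dist_smul, hf.dist_zpow]; push_cast
    exact abs_of_nonneg (by positivity)
  set H := h • x₀
  set E := h • f ^ (n : ℤ) • x₀
  set E' := h • f ^ ((n : ℤ) + D) • x₀
  have h4 : gromovProd E H E' = 0 := by
    simp only [gromovProd]; rw [dist_comm E H]; linarith
  have h5 : δ < gromovProd E p E' := by
    simp only [gromovProd]; rw [dist_comm E p]; linarith
  have h6 : gromovProd E H p ≤ gromovProd E H E' + δ := hF.left_le (by linarith)
  have h7 := gromovProd_add_gromovProd H E p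
  rw [gromovProd_comm]
  linarith

lemma two_pow_mul_card_le_card_mul_pow {G : Type*} [Group G] [DecidableEq G] {W : Finset G}
    (h : ∀ B : Finset G, 2 * B.card ≤ (B * W).card) (B : Finset G) (k : ℕ) :
    2 ^ k * B.card ≤ (B * W ^ k).card := by
  induction k with
  | zero => simp
  | succ k ih =>
    rw [pow_succ W, ← mul_assoc]
    exact le_trans (by rw [pow_succ']; linarith) (h (B * W ^ k))

/-- All but a small proportion of the elements of `A` have a nearby halfspace avoiding `A`. -/
lemma WPD.exists_supporting_halfspace {δ : ℝ} (hF : FourPoint X δ) {f : G} {x₀ : X}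
    (hf : IsAxialOrbit f x₀) (hw : WPD f x₀) (hG : ¬ VirtuallyCyclic G) {D : ℤ}
    (hD : 0 ≤ D) (hδD : 2 * δ ≤ D) {ε : ℝ} (hε : 0 < ε) :
    ∃ V : Finset G, ∀ A : Finset G, ∃ A' ⊆ A, (1 - ε) * A.card ≤ A'.card ∧
      ∀ a ∈ A', ∃ v ∈ V, (fun g : G => g • x₀) '' (A : Set G) ⊆
        halfspace ((a * v) • x₀) ((a * v * f ^ D) • x₀) := by
  classical
  obtain ⟨z, C, hz⟩ := hw.exists_transverse hF hf hG
  obtain ⟨W, n, hW⟩ := hw.exists_doubling hF hf hz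
  have hδ := hF.nonneg x₀
  obtain ⟨k, hk⟩ := exists_pow_lt_of_lt_one hε (one_half_lt_one : (1 / 2 : ℝ) < 1)
  have hgrow : ∀ B : Finset G, 2 * B.card ≤ (B * W).card := by
    intro B
    refine (hW B ((B * W).image fun h => h • f ^ (n : ℤ) • x₀) fun b hb w hw => ?_).trans
      Finset.card_image_le
    refine ⟨_, Finset.mem_image_of_mem _ (Finset.mul_mem_mul hb hw), ?_⟩
    rw [gromovProd_self, dist_smul, hf.dist_zpow]
    simpa using hδ
  refine ⟨(W ^ k * W).image fun v => v * f ^ (n : ℤ), fun A => ?_⟩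
  set good : G → Prop := fun a => ∃ v ∈ (W ^ k * W).image fun v => v * f ^ (n : ℤ),
    (fun g : G => g • x₀) '' (A : Set G) ⊆ halfspace ((a * v) • x₀) ((a * v * f ^ D) • x₀)
  refine ⟨A.filter good, Finset.filter_subset _ _, ?_, fun a ha => (Finset.mem_filter.mp ha).2⟩
  set B := A.filter fun a => ¬ good a with hB
  have hBA : 2 * (B * W ^ k).card ≤ (A.image fun g => g • x₀).card := by
    refine hW _ _ fun b hb w hw => ?_
    obtain ⟨a, ha, v, hv, rfl⟩ := Finset.mem_mul.mp hb
    have hbad := (Finset.mem_filter.mp ha).2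
    have h1 : ¬ (fun g : G => g • x₀) '' (A : Set G) ⊆
        halfspace ((a * (v * w * f ^ (n : ℤ))) • x₀) ((a * (v * w * f ^ (n : ℤ)) * f ^ D) • x₀) :=
      fun h => hbad ⟨_, Finset.mem_image_of_mem _ (Finset.mul_mem_mul hv hw), h⟩
    rw [Set.not_subset] at h1
    obtain ⟨_, ⟨g, hg, rfl⟩, hgn⟩ := h1
    refine ⟨g • x₀, Finset.mem_image_of_mem _ hg, ?_⟩
    refine le_gromovProd_of_notMem_halfspace hF hf hD hδD ?_
    simpa only [mul_assoc] using hgn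
  have h1 := two_pow_mul_card_le_card_mul_pow hgrow B k
  have h2 : (A.image fun g => g • x₀).card ≤ A.card := Finset.card_image_le
  have h3 : (A.filter good).card + B.card = A.card := Finset.card_filter_add_card_filter_not good
  have h4 : 2 ^ k * B.card ≤ A.card := by omega
  have h5 : (B.card : ℝ) ≤ ε * A.card := by
    have h6 : (2 : ℝ) ^ k * B.card ≤ A.card := by exact_mod_cast h4
    calc (B.card : ℝ) = (1 / 2) ^ k * (2 ^ k * B.card) := by
          rw [← mul_assoc, ← mul_pow]; norm_num
      _ ≤ (1 / 2) ^ k * A.card := by gcongr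
      _ ≤ ε * A.card := by gcongr
  have h6 : ((A.filter good).card : ℝ) + B.card = A.card := by exact_mod_cast h3
  linarith

end Halfspace

lemma isAxialOrbit_of_line {X : Type*} [MetricSpace X] {G : Type*} [Group G] [MulAction G X]
    {f : G} {ℓ : ℝ → X} (hgeo : ∀ s t : ℝ, dist (ℓ s) (ℓ t) = |s - t|)
    (haxis : ∀ t : ℝ, f • ℓ t = ℓ (t + 1)) (t : ℝ) : IsAxialOrbit f (ℓ t) := by
  have h : ∀ (k : ℕ) (t : ℝ), f ^ k • ℓ t = ℓ (t + k) := by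
    intro k
    induction k with
    | zero => simp
    | succ k ih =>
      intro t
      rw [pow_succ, mul_smul, haxis, ih]
      push_cast; congr 1; ring
  have h' : ∀ k : ℤ, f ^ k • ℓ t = ℓ (t + k) := by
    intro k
    obtain ⟨n, rfl | rfl⟩ := k.eq_nat_or_neg
    · rw [zpow_natCast, h]; simp
    · rw [zpow_neg, inv_smul_eq_iff, zpow_natCast, h]
      push_cast; congr 1; ring
  intro i j
  rw [h', h', hgeo]
  congr 1; ring

/-- **Supporting hyperplane lemma** for WPD actions on Gromov hyperbolic spaces. -/
theorem supporting_hyperplane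
    {X : Type*} [MetricSpace X] {G : Type*} [Group G] [MulAction G X]
    (δ : ℝ) (hX : GromovHyperbolic X δ)
    (hiso : ∀ (g : G) (x y : X), dist (g • x) (g • y) = dist x y)
    (hnvc : ¬ VirtuallyCyclic G)
    (f : G) (ℓ : ℝ → X) (hgeo : ∀ s t : ℝ, dist (ℓ s) (ℓ t) = |s - t|)
    (haxis : ∀ t : ℝ, f • ℓ t = ℓ (t + 1))
    (x₀ : X) (hx₀ : x₀ ∈ Set.range ℓ) (hwpd : WPD f x₀)
    (S : Finset G) (hgen : Subgroup.closure (S : Set G) = ⊤) :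
    ∃ D₀ : ℝ, 0 < D₀ ∧ ∃ w ∈ S, ∀ ε : ℝ, 0 < ε → ∀ D : ℤ, D₀ < (D : ℝ) →
      ∃ N : ℕ, ∀ A : Finset G,
        ∃ A' : Finset G, A' ⊆ A ∧ (1 - ε) * (A.card : ℝ) ≤ (A'.card : ℝ) ∧
          ∀ a ∈ A', ∃ b : G, wordDist S a b ≤ N ∧
            ((fun g : G => g • x₀) '' (A : Set G)) ⊆
                halfspace (b • x₀) ((b * f ^ D) • x₀) ∧
            Disjoint (halfspace (b • x₀) ((b * f ^ D) • x₀))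
              ((b * f ^ D * w * f ^ (-D) * b⁻¹) •
                halfspace (b • x₀) ((b * f ^ D) • x₀)) := by
  have : IsIsometricSMul G X := ⟨fun g => Isometry.of_dist_eq (hiso g)⟩
  have hF := hX.fourPoint
  have hf : IsAxialOrbit f x₀ := by
    obtain ⟨t, rfl⟩ := hx₀
    exact isAxialOrbit_of_line hgeo haxis t
  obtain ⟨w, hwS, C, hC⟩ := hwpd.exists_generator hF hf hnvc hgen
  set δ' := 3 * δ + 1
  have hδ := hF.nonneg x₀
  have hC0 : 0 ≤ C := (gromovProd_nonneg _ _ _).trans (hC 0 0)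
  have hw0 : 0 ≤ dist x₀ (w • x₀) := dist_nonneg
  refine ⟨2 * (C + δ' + dist x₀ (w • x₀)) + 1, by positivity, w, hwS, fun ε hε D hD => ?_⟩
  have hD0 : 0 ≤ D := by
    have : (0 : ℝ) ≤ D := by linarith
    exact_mod_cast this
  obtain ⟨V, hV⟩ := hwpd.exists_supporting_halfspace hF hf hnvc hD0 (by linarith) hε
  refine ⟨V.sup (wordNorm S), fun A => ?_⟩
  obtain ⟨A', hA', hcard, hsupp⟩ := hV A
  refine ⟨A', hA', hcard, fun a ha => ?_⟩
  obtain ⟨v, hv, hsub⟩ := hsupp a ha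
  refine ⟨a * v, ?_, hsub, disjoint_halfspace_smul hF hf hC hD0 (by linarith) _⟩
  rw [wordDist, inv_mul_cancel_left]
  exact Finset.le_sup hv
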